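/- Let L = (V,E) be one of the square, triangular, or hexagonal lattices embedded in the plane, let p = (p_e : e ∈ E) ∈ [0,1]^E, let P_p be the product measure under which edge e is open with probability p_e, and let P*_{1−p} be the product measure on the dual lattice L* under which the dual edge e* of e is open with probability 1 − p_e. Suppose P*_{1−p} has the box-crossing property. Then: (a) there exist a, b > 0 such that for every vertex v ∈ V, P_p(rad(C_v) ≥ k) ≤ a·k^{−b} for all k ≥ 1; (b) P_p-almost surely there is no infinite open cluster; (c) for every ν > 0 there exist c, d > 0 such that for every vertex v ∈ V, the measure \underline{P}_{p−ν} satisfies \underline{P}_{p−ν}(|C_v| ≥ k) ≤ c·e^{−dk} for all k ≥ 0. -/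

import Mathlib

open MeasureTheory Set

set_option linter.unusedVariables false

namespace Perc

/-- Points of the plane. -/
abbrev Pt := ℝ × ℝ

/-- A lattice embedded in the plane, with edges indexed by `E`;
each edge is embedded as the segment between the two endpoints given by `ends`. -/
structure LatticeOn (E : Type) where
  ends : E → Pt × Pt

/-- Bond configurations. -/
abbrev Config (E : Type) := E → Bool

/-- `P` is the Bernoulli bond-percolation product measure in which edge `e`
is open with probability `p e`, independently over edges. -/
def IsBernoulliProduct {E : Type} (p : E → ℝ) (P : Measure (Config E)) : Prop :=
  IsProbabilityMeasure P ∧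
    ∀ (s : Finset E) (f : E → Bool),
      P {ω | ∀ e ∈ s, ω e = f e} =
        ∏ e ∈ s, ENNReal.ofReal (if f e then p e else 1 - p e)

/-- The union of the closed segments of the open edges. -/
def openEdgeSet {E : Type} (L : LatticeOn E) (ω : Config E) : Set Pt :=
  ⋃ e ∈ {e : E | ω e = true}, segment ℝ (L.ends e).1 (L.ends e).2

/-- There is an arc, contained in `S` and in the union of the open edges,
with one endpoint in `A` and the other in `B`. -/
def CrossingIn {E : Type} (L : LatticeOn E) (ω : Config E) (S A B : Set Pt) : Prop :=
  ∃ γ : ℝ → Pt, ContinuousOn γ (Icc 0 1) ∧ γ 0 ∈ A ∧ γ 1 ∈ B ∧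
    ∀ t ∈ Icc (0:ℝ) 1, γ t ∈ S ∩ openEdgeSet L ω

/-- Rotation of the plane by angle `θ`. -/
noncomputable def rot (θ : ℝ) (z : Pt) : Pt :=
  (Real.cos θ * z.1 - Real.sin θ * z.2, Real.sin θ * z.1 + Real.cos θ * z.2)

/-- `f` comprises a rotation and a translation. -/
def IsRotTrans (f : Pt → Pt) : Prop := ∃ θ : ℝ, ∃ t : Pt, f = fun z => rot θ z + t

def stdRect (h l : ℝ) : Set Pt := {z | 0 ≤ z.1 ∧ z.1 ≤ h ∧ 0 ≤ z.2 ∧ z.2 ≤ l}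
def leftSide (h l : ℝ) : Set Pt := {z | z.1 = 0 ∧ 0 ≤ z.2 ∧ z.2 ≤ l}
def rightSide (h l : ℝ) : Set Pt := {z | z.1 = h ∧ 0 ≤ z.2 ∧ z.2 ≤ l}
def bottomSide (h l : ℝ) : Set Pt := {z | z.2 = 0 ∧ 0 ≤ z.1 ∧ z.1 ≤ h}
def topSide (h l : ℝ) : Set Pt := {z | z.2 = l ∧ 0 ≤ z.1 ∧ z.1 ≤ h}

/-- The box `f(stdRect h l)` (where `f` is a rotation plus translation) possesses
open crossings in both directions. -/
def HasBoxCrossings {E : Type} (L : LatticeOn E) (ω : Config E) (h l : ℝ) (f : Pt → Pt) : Prop :=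
  CrossingIn L ω (f '' stdRect h l) (f '' leftSide h l) (f '' rightSide h l) ∧
  CrossingIn L ω (f '' stdRect h l) (f '' bottomSide h l) (f '' topSide h l)

/-- The box-crossing property: for every `α > 0` there is `δ > 0` such that every box
of size `αN × N` (any position and orientation) possesses open crossings with
probability at least `δ`, for all large `N`. -/
def BoxCrossingProperty {E : Type} (L : LatticeOn E) (P : Measure (Config E)) : Prop :=
  ∀ α : ℝ, 0 < α → ∃ δ : ℝ, 0 < δ ∧ ∃ N₀ : ℕ, ∀ N : ℕ, N₀ ≤ N →
    ∀ f : Pt → Pt, IsRotTrans f →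
      ENNReal.ofReal δ ≤ P {ω | HasBoxCrossings L ω (α * N) N f}

/-- Horizontal-crossing event of the box `[-m,m] × [0,n]`. -/
def Ch {E : Type} (L : LatticeOn E) (m n : ℝ) (ω : Config E) : Prop :=
  CrossingIn L ω {z | -m ≤ z.1 ∧ z.1 ≤ m ∧ 0 ≤ z.2 ∧ z.2 ≤ n}
    {z | z.1 = -m ∧ 0 ≤ z.2 ∧ z.2 ≤ n} {z | z.1 = m ∧ 0 ≤ z.2 ∧ z.2 ≤ n}

/-- Vertical-crossing event of the box `[-m,m] × [0,n]`. -/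
def Cv {E : Type} (L : LatticeOn E) (m n : ℝ) (ω : Config E) : Prop :=
  CrossingIn L ω {z | -m ≤ z.1 ∧ z.1 ≤ m ∧ 0 ≤ z.2 ∧ z.2 ≤ n}
    {z | z.2 = 0 ∧ -m ≤ z.1 ∧ z.1 ≤ m} {z | z.2 = n ∧ -m ≤ z.1 ∧ z.1 ≤ m}

/-- `u` and `v` are the endpoints of some open edge. -/
def openAdj {E : Type} (L : LatticeOn E) (ω : Config E) (u v : Pt) : Prop :=
  ∃ e, ω e = true ∧ (L.ends e = (u, v) ∨ L.ends e = (v, u))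

/-- `u` and `v` are joined by a path of open edges. -/
def openConn {E : Type} (L : LatticeOn E) (ω : Config E) : Pt → Pt → Prop :=
  Relation.ReflTransGen (openAdj L ω)

/-- The open cluster at `v`. -/
def cluster {E : Type} (L : LatticeOn E) (ω : Config E) (v : Pt) : Set Pt :=
  {u | openConn L ω v u}

/-- The vertex set of the lattice. -/
def vertexSet {E : Type} (L : LatticeOn E) : Set Pt :=
  ⋃ e : E, {(L.ends e).1, (L.ends e).2}

/-- `v` is the endpoint of an infinite open self-avoiding path. -/
def ConnToInfinity {E : Type} (L : LatticeOn E) (ω : Config E) (v : Pt) : Prop :=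
  ∃ γ : ℕ → Pt, γ 0 = v ∧ Function.Injective γ ∧ ∀ n, openAdj L ω (γ n) (γ (n + 1))

/-- Euclidean distance on the plane. -/
noncomputable def edist2 (u v : Pt) : ℝ := Real.sqrt ((u.1 - v.1) ^ 2 + (u.2 - v.2) ^ 2)

/-- `rad (C_v) ≥ r`, where `rad (C_v)` is the supremum of all `x` such that `C_v`
meets the complement of the open Euclidean ball `v + S_x`. -/
def RadiusGE {E : Type} (L : LatticeOn E) (ω : Config E) (v : Pt) (r : ℝ) : Prop :=
  ∀ x : ℝ, x < r → ∃ u ∈ cluster L ω v, x ≤ edist2 v u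

/-- `κ_□`. -/
def kappaS (a b : ℝ) : ℝ := a + b - 1
/-- `κ_△`. -/
def kappaT (a b c : ℝ) : ℝ := a + b + c - a * b * c - 1
/-- `κ_⬡`. -/
def kappaH (a b c : ℝ) : ℝ := -kappaT (1 - a) (1 - b) (1 - c)

/-- Edges of a square-type lattice: `(a, b, true)` is the `horizontal`-class edge
at `(a,b)` and `(a, b, false)` the `vertical`-class edge at `(a,b)`. -/
abbrev SqE := ℤ × ℤ × Bool
/-- Edges of the triangular lattice (also indexing the dual hexagonal edges):
`(a, b, i)` with `i = 0` horizontal, `i = 1` the right edge of an upwards pointing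
triangle, `i = 2` the left edge of an upwards pointing triangle, in row `b`. -/
abbrev TriE := ℤ × ℤ × Fin 3

/-- The unit square lattice, with vertex set `ℤ²`. -/
noncomputable def sqLattice : LatticeOn SqE :=
  ⟨fun e =>
    if e.2.2 then (((e.1 : ℝ), (e.2.1 : ℝ)), ((e.1 : ℝ) + 1, (e.2.1 : ℝ)))
    else (((e.1 : ℝ), (e.2.1 : ℝ)), ((e.1 : ℝ), (e.2.1 : ℝ) + 1))⟩

/-- The dual of the unit square lattice (shifted by `(1/2, 1/2)`), with each dual edge
indexed by the primal edge it crosses. -/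
noncomputable def sqDualLattice : LatticeOn SqE :=
  ⟨fun e =>
    if e.2.2 then
      (((e.1 : ℝ) + 1 / 2, (e.2.1 : ℝ) - 1 / 2), ((e.1 : ℝ) + 1 / 2, (e.2.1 : ℝ) + 1 / 2))
    else
      (((e.1 : ℝ) - 1 / 2, (e.2.1 : ℝ) + 1 / 2), ((e.1 : ℝ) + 1 / 2, (e.2.1 : ℝ) + 1 / 2))⟩

/-- Vertices of the triangular lattice (equilateral triangles of side `√3`,
one family of edges horizontal). -/
noncomputable def tv (a b : ℤ) : Pt :=
  (Real.sqrt 3 * ((a : ℝ) + (b : ℝ) / 2), 3 / 2 * (b : ℝ))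

/-- The triangular lattice. -/
noncomputable def triLattice : LatticeOn TriE :=
  ⟨fun e =>
    if e.2.2 = 0 then (tv e.1 e.2.1, tv (e.1 + 1) e.2.1)
    else if e.2.2 = 1 then (tv (e.1 + 1) e.2.1, tv e.1 (e.2.1 + 1))
    else (tv e.1 e.2.1, tv e.1 (e.2.1 + 1))⟩

/-- Circumcentre of the upwards pointing triangle with base vertex `tv a b`. -/
noncomputable def hup (a b : ℤ) : Pt :=
  (Real.sqrt 3 * ((a : ℝ) + ((b : ℝ) + 1) / 2), 3 / 2 * (b : ℝ) + 1 / 2)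

/-- Circumcentre of the downwards pointing triangle below the edge `tv a b – tv (a+1) b`. -/
noncomputable def hdown (a b : ℤ) : Pt :=
  (Real.sqrt 3 * ((a : ℝ) + ((b : ℝ) + 1) / 2), 3 / 2 * (b : ℝ) - 1 / 2)

/-- The hexagonal lattice, the planar dual of `triLattice`, with vertices at the
circumcentres of the triangles; each hexagonal edge is indexed by the triangular
edge it crosses. -/
noncomputable def hexLattice : LatticeOn TriE :=
  ⟨fun e =>
    if e.2.2 = 0 then (hdown e.1 e.2.1, hup e.1 e.2.1)
    else if e.2.2 = 1 then (hup e.1 e.2.1, hdown e.1 (e.2.1 + 1))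
    else (hup e.1 e.2.1, hdown (e.1 - 1) (e.2.1 + 1))⟩

/-- The square lattice with horizontal edges of length `√3` and vertical edges of
length `1` (as in the mixed lattices). -/
noncomputable def sqStretch : LatticeOn SqE :=
  ⟨fun e =>
    if e.2.2 then
      ((Real.sqrt 3 * (e.1 : ℝ), (e.2.1 : ℝ)), (Real.sqrt 3 * ((e.1 : ℝ) + 1), (e.2.1 : ℝ)))
    else ((Real.sqrt 3 * (e.1 : ℝ), (e.2.1 : ℝ)), (Real.sqrt 3 * (e.1 : ℝ), (e.2.1 : ℝ) + 1))⟩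

/-- Vertices of the square lattice rotated by `π/4`. -/
noncomputable def rv (a b : ℤ) : Pt :=
  (((a : ℝ) - (b : ℝ)) / Real.sqrt 2, ((a : ℝ) + (b : ℝ)) / Real.sqrt 2)

/-- The square lattice rotated by `π/4`: edges `(a,b,true)` are inclined at angle `π/4`
and edges `(a,b,false)` at angle `3π/4`; the row (height) of such an edge is `a + b`. -/
noncomputable def rsqLattice : LatticeOn SqE :=
  ⟨fun e =>
    if e.2.2 then (rv e.1 e.2.1, rv (e.1 + 1) e.2.1)
    else (rv e.1 e.2.1, rv e.1 (e.2.1 + 1))⟩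

/-- Inhomogeneous intensities on the square lattice: `ph` on horizontal edges,
`pv` on vertical ones. -/
def sqInt (ph pv : ℝ) : SqE → ℝ := fun e => if e.2.2 then ph else pv

/-- Inhomogeneous intensities on the triangular (or hexagonal) lattice:
`p0` on class-0 edges, `p1` on class-1, `p2` on class-2. -/
def triInt (p0 p1 p2 : ℝ) : TriE → ℝ := fun e => ![p0, p1, p2] e.2.2

/-- Highly inhomogeneous intensities on the triangular (or hexagonal) lattice:
`p` on horizontal-class edges, `q n` on right edges of upwards pointing triangles at
height `n`, `q' n` on left edges of upwards pointing triangles at height `n`. -/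
def triHI (p : ℝ) (q q' : ℤ → ℝ) : TriE → ℝ := fun e =>
  if e.2.2 = 0 then p else if e.2.2 = 1 then q e.2.1 else q' e.2.1

/-- Highly inhomogeneous intensities on the rotated square lattice: `q n` on edges
inclined at `π/4` at height `n`, `q' n` on edges inclined at `3π/4` at height `n`. -/
def rsqHI (q q' : ℤ → ℝ) : SqE → ℝ := fun e =>
  if e.2.2 then q (e.1 + e.2.1) else q' (e.1 + e.2.1)


/-- Sub-criticality consequences of the box-crossing property for the dual measure,
for a primal/dual pair `(L, Ld)` of lattices sharing the edge index type (each dual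
edge indexed by the primal edge it crosses). -/
def SubcriticalityViaBXP {E : Type} (L Ld : LatticeOn E) : Prop :=
  ∀ p : E → ℝ, (∀ e, p e ∈ Set.Icc (0 : ℝ) 1) →
  ∀ Pd : Measure (Config E), IsBernoulliProduct (fun e => 1 - p e) Pd →
    BoxCrossingProperty Ld Pd →
  ∀ P : Measure (Config E), IsBernoulliProduct p P →
    -- (a) polynomial decay of the radius
    ((∃ a : ℝ, 0 < a ∧ ∃ b : ℝ, 0 < b ∧
        ∀ v ∈ vertexSet L, ∀ k : ℕ, 1 ≤ k →
          P {ω | RadiusGE L ω v k} ≤ ENNReal.ofReal (a * (k : ℝ) ^ (-b))) ∧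
    -- (b) a.s. no infinite open cluster
     (P {ω | ∃ v ∈ vertexSet L, (cluster L ω v).Infinite} = 0) ∧
    -- (c) exponential decay of the volume for the reduced intensities
     (∀ ν : ℝ, 0 < ν → ∃ c : ℝ, 0 < c ∧ ∃ d : ℝ, 0 < d ∧
        ∀ Pu : Measure (Config E),
          IsBernoulliProduct (fun e => if p e = 1 then 1 else max (p e - ν) 0) Pu →
          ∀ v ∈ vertexSet L, ∀ k : ℕ,
            Pu {ω | (k : ℕ∞) ≤ (cluster L ω v).encard} ≤
              ENNReal.ofReal (c * Real.exp (-d * k))))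

/-- A continuous real function on `[0,1]` with non-negative cosine stays within `π/2` of a
single multiple of `2π`. -/
lemma exists_int_abs_sub_le_of_cos_nonneg {θ : ℝ → ℝ} (hc : Continuous θ)
    (h : ∀ t ∈ Icc (0:ℝ) 1, 0 ≤ Real.cos (θ t)) :
    ∃ k : ℤ, ∀ t ∈ Icc (0:ℝ) 1, |θ t - 2 * Real.pi * k| ≤ Real.pi / 2 := by
  have hpi := Real.pi_pos
  refine ⟨round (θ 0 / (2 * Real.pi)), fun t ht => ?_⟩
  set k := round (θ 0 / (2 * Real.pi)) with hk
  have h0 : |θ 0 - 2 * Real.pi * k| ≤ Real.pi := by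
    have h1 := abs_sub_round (θ 0 / (2 * Real.pi))
    rw [← hk] at h1
    have : θ 0 - 2 * Real.pi * k = (2 * Real.pi) * (θ 0 / (2 * Real.pi) - k) := by
      field_simp
    rw [this, abs_mul, abs_of_pos (by positivity : 0 < 2 * Real.pi)]
    nlinarith
  have hcos : ∀ s ∈ Icc (0:ℝ) 1, ∀ c, θ s - 2 * Real.pi * k = c → Real.pi / 2 < |c| →
      |c| ≤ Real.pi → False := by
    intro s hs c hc1 hc2 hc3
    have h1 := h s hs
    have h2 : θ s = c + k * (2 * Real.pi) := by linarith
    rw [h2, Real.cos_add_int_mul_two_pi, ← Real.cos_abs] at h1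
    have := Real.cos_neg_of_pi_div_two_lt_of_lt hc2 (by linarith)
    linarith
  have h0' : |θ 0 - 2 * Real.pi * k| ≤ Real.pi / 2 := by
    by_contra hcon
    exact hcos 0 (by simp) _ rfl (not_le.1 hcon) h0
  by_contra hcon
  have hcon' := not_le.1 hcon
  have hcont : Continuous fun s => |θ s - 2 * Real.pi * k| := by fun_prop
  obtain ⟨s, hs, hs2⟩ := intermediate_value_Icc ht.1 hcont.continuousOn
    (show min (|θ t - 2 * Real.pi * k|) (3 / 4 * Real.pi) ∈ _ from
      ⟨le_min (by linarith) (by linarith), min_le_left _ _⟩)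
  refine hcos s ⟨hs.1, hs.2.trans ht.2⟩ _ rfl ?_ ?_
  · simp only at hs2
    rw [hs2]; exact lt_min hcon' (by linarith)
  · simp only at hs2
    rw [hs2]; exact (min_le_right _ _).trans (by linarith)

/-- The two-dimensional Poincaré–Miranda theorem. -/
lemma poincare_miranda {f g : ℝ × ℝ → ℝ} (hf : Continuous f) (hg : Continuous g)
    (hf0 : ∀ t ∈ Icc (0:ℝ) 1, f (0, t) ≤ 0) (hf1 : ∀ t ∈ Icc (0:ℝ) 1, 0 ≤ f (1, t))
    (hg0 : ∀ s ∈ Icc (0:ℝ) 1, 0 ≤ g (s, 0)) (hg1 : ∀ s ∈ Icc (0:ℝ) 1, g (s, 1) ≤ 0) :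
    ∃ z, f z = 0 ∧ g z = 0 := by
  by_contra hcon
  push Not at hcon
  have hpi := Real.pi_pos
  obtain ⟨l, hl, hle⟩ := Complex.exists_continuousOn_eqOn_exp_comp
    (U := (univ : Set (ℝ × ℝ))) (g := fun z => (f z : ℂ) + g z * Complex.I)
    (show SimplyConnectedSpace (univ : Set (ℝ × ℝ)) from
      (Homeomorph.Set.univ (ℝ × ℝ)).toHomotopyEquiv.simplyConnectedSpace)
    isOpen_univ (by fun_prop) (by
      rintro ⟨z, -, hz⟩
      have h1 := congrArg Complex.re hz
      have h2 := congrArg Complex.im hz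
      simp at h1 h2
      exact hcon z h1 h2)
  have hlc : Continuous l := continuousOn_univ.1 hl
  have hre : ∀ z, f z = Real.exp (l z).re * Real.cos (l z).im := fun z => by
    have := congrArg Complex.re (hle (mem_univ z))
    simpa [Complex.exp_re] using this.symm
  have him : ∀ z, g z = Real.exp (l z).re * Real.sin (l z).im := fun z => by
    have := congrArg Complex.im (hle (mem_univ z))
    simpa [Complex.exp_im] using this.symm
  have hθ : Continuous fun z => (l z).im := by fun_prop
  have key : ∀ (u : ℝ → ℝ × ℝ) (φ : ℝ), Continuous u →
      (∀ t ∈ Icc (0:ℝ) 1, 0 ≤ Real.cos ((l (u t)).im - φ)) →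
      ∃ k : ℤ, ∀ t ∈ Icc (0:ℝ) 1, |(l (u t)).im - φ - 2 * Real.pi * k| ≤ Real.pi / 2 :=
    fun u φ hu h => exists_int_abs_sub_le_of_cos_nonneg (by fun_prop) h
  obtain ⟨k1, h1⟩ := key (fun t => (1, t)) 0 (by fun_prop) fun t ht => by
    have := hf1 t ht
    rw [hre] at this
    simpa using nonneg_of_mul_nonneg_right this (Real.exp_pos _)
  obtain ⟨k2, h2⟩ := key (fun t => (t, 0)) (Real.pi / 2) (by fun_prop) fun t ht => by
    have := hg0 t ht
    rw [him] at this
    rw [Real.cos_sub_pi_div_two]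
    exact nonneg_of_mul_nonneg_right this (Real.exp_pos _)
  obtain ⟨k3, h3⟩ := key (fun t => (0, t)) Real.pi (by fun_prop) fun t ht => by
    have := hf0 t ht
    rw [hre] at this
    rw [Real.cos_sub_pi]
    have := Real.exp_pos (l (0, t)).re
    nlinarith
  obtain ⟨k4, h4⟩ := key (fun t => (t, 1)) (Real.pi + Real.pi / 2) (by fun_prop) fun t ht => by
    have := hg1 t ht
    rw [him] at this
    rw [← sub_sub, Real.cos_sub_pi_div_two, Real.sin_sub_pi]
    have := Real.exp_pos (l (t, 1)).re
    nlinarith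
  have z0 : (0:ℝ) ∈ Icc (0:ℝ) 1 := by simp
  have z1 : (1:ℝ) ∈ Icc (0:ℝ) 1 := by simp
  have a1 := abs_le.1 (h1 0 z0)
  have b1 := abs_le.1 (h1 1 z1)
  have a2 := abs_le.1 (h2 0 z0)
  have b2 := abs_le.1 (h2 1 z1)
  have a3 := abs_le.1 (h3 0 z0)
  have b3 := abs_le.1 (h3 1 z1)
  have a4 := abs_le.1 (h4 0 z0)
  have b4 := abs_le.1 (h4 1 z1)
  have up : ∀ a b : ℤ, 2 * Real.pi * a < 2 * Real.pi * (b + 1) → a ≤ b := fun a b h => by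
    have h' : (a : ℝ) < b + 1 := lt_of_mul_lt_mul_left h (by positivity)
    exact_mod_cast Int.lt_add_one_iff.1 (by exact_mod_cast h')
  have e1 := up k1 k2 (by linarith)
  have e2 := up k2 k3 (by linarith)
  have e3 := up k3 k4 (by linarith)
  have e4 : k4 + 1 ≤ k1 := up (k4 + 1) k1 (by push_cast; linarith)
  omega

/-- Two curves crossing a region in transverse directions meet. -/
lemma exists_eq_of_crossing {α β : ℝ → Pt} (hα : Continuous α) (hβ : Continuous β)
    (x y : Pt → ℝ) (hx : Continuous x) (hy : Continuous y)
    (hxy : ∀ a b, x a = x b → y a = y b → a = b)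
    (h0 : ∀ t ∈ Icc (0:ℝ) 1, x (α 0) ≤ x (β t)) (h1 : ∀ t ∈ Icc (0:ℝ) 1, x (β t) ≤ x (α 1))
    (h2 : ∀ s ∈ Icc (0:ℝ) 1, y (β 0) ≤ y (α s)) (h3 : ∀ s ∈ Icc (0:ℝ) 1, y (α s) ≤ y (β 1)) :
    ∃ s t, α s = β t := by
  obtain ⟨⟨s, t⟩, h, h'⟩ := poincare_miranda
    (f := fun z => x (α z.1) - x (β z.2)) (g := fun z => y (α z.1) - y (β z.2))
    (by fun_prop) (by fun_prop) (fun t ht => by simpa using h0 t ht)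
    (fun t ht => by simpa using h1 t ht) (fun t ht => by simpa using h2 t ht)
    (fun t ht => by simpa using h3 t ht)
  exact ⟨s, t, hxy _ _ (sub_eq_zero.1 h) (sub_eq_zero.1 h')⟩

section Expectation

open scoped Classical

variable {E : Type}

/-- The expectation of `g`, as a function of the set of open edges in the finite set `F`,
when each edge `e` is open with probability `p e` independently. -/
noncomputable def Ex (p : E → ℝ) (F : Finset E) (g : Finset E → ℝ) : ℝ :=
  ∑ B ∈ F.powerset, (∏ e ∈ F, if e ∈ B then p e else 1 - p e) * g B

lemma Ex_empty (p : E → ℝ) (g : Finset E → ℝ) : Ex p ∅ g = g ∅ := by simp [Ex]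

lemma Ex_insert (p : E → ℝ) {e : E} {F : Finset E} (he : e ∉ F) (g : Finset E → ℝ) :
    Ex p (insert e F) g = p e * Ex p F (fun B => g (insert e B)) + (1 - p e) * Ex p F g := by
  unfold Ex
  rw [Finset.sum_powerset_insert he, add_comm, Finset.mul_sum, Finset.mul_sum]
  congr 1
  · refine Finset.sum_congr rfl fun B hB => ?_
    rw [Finset.prod_insert he, if_pos (Finset.mem_insert_self e B), mul_assoc]
    congr 2
    refine Finset.prod_congr rfl fun a ha => ?_
    have : a ≠ e := fun h => he (h ▸ ha)
    simp [this]
  · refine Finset.sum_congr rfl fun B hB => ?_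
    rw [Finset.prod_insert he, if_neg fun h => he (Finset.mem_powerset.1 hB h), mul_assoc]

lemma Ex_congr {p : E → ℝ} {F : Finset E} {g h : Finset E → ℝ} (H : ∀ B ⊆ F, g B = h B) :
    Ex p F g = Ex p F h :=
  Finset.sum_congr rfl fun B hB => by rw [H B (Finset.mem_powerset.1 hB)]

lemma Ex_add (p : E → ℝ) (F : Finset E) (g h : Finset E → ℝ) :
    Ex p F (fun B => g B + h B) = Ex p F g + Ex p F h := by
  simp [Ex, mul_add, Finset.sum_add_distrib]

lemma Ex_sub (p : E → ℝ) (F : Finset E) (g h : Finset E → ℝ) :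
    Ex p F (fun B => g B - h B) = Ex p F g - Ex p F h := by
  simp [Ex, mul_sub, Finset.sum_sub_distrib]

lemma Ex_const_mul (p : E → ℝ) (F : Finset E) (c : ℝ) (g : Finset E → ℝ) :
    Ex p F (fun B => c * g B) = c * Ex p F g := by
  simp only [Ex, Finset.mul_sum]
  exact Finset.sum_congr rfl fun B _ => by ring

lemma Ex_sum {ι : Type*} (p : E → ℝ) (F : Finset E) (s : Finset ι) (g : ι → Finset E → ℝ) :
    Ex p F (fun B => ∑ i ∈ s, g i B) = ∑ i ∈ s, Ex p F (g i) := by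
  simp only [Ex, Finset.mul_sum]
  exact Finset.sum_comm

lemma Ex_const (p : E → ℝ) (F : Finset E) (c : ℝ) : Ex p F (fun _ => c) = c := by
  induction F using Finset.induction_on with
  | empty => simp [Ex_empty]
  | insert e F he ih => rw [Ex_insert p he, ih]; ring

lemma weight_nonneg {p : E → ℝ} (hp : ∀ e, p e ∈ Icc (0:ℝ) 1) (F B : Finset E) :
    0 ≤ ∏ e ∈ F, if e ∈ B then p e else 1 - p e :=
  Finset.prod_nonneg fun e _ => by
    have := hp e
    split_ifs
    · exact this.1
    · linarith [this.2]

lemma Ex_mono {p : E → ℝ} (hp : ∀ e, p e ∈ Icc (0:ℝ) 1) {F : Finset E} {g h : Finset E → ℝ}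
    (H : ∀ B ⊆ F, g B ≤ h B) : Ex p F g ≤ Ex p F h :=
  Finset.sum_le_sum fun B hB =>
    mul_le_mul_of_nonneg_left (H B (Finset.mem_powerset.1 hB)) (weight_nonneg hp F B)

lemma Ex_nonneg {p : E → ℝ} (hp : ∀ e, p e ∈ Icc (0:ℝ) 1) {F : Finset E} {g : Finset E → ℝ}
    (H : ∀ B ⊆ F, 0 ≤ g B) : 0 ≤ Ex p F g :=
  Finset.sum_nonneg fun B hB =>
    mul_nonneg (weight_nonneg hp F B) (H B (Finset.mem_powerset.1 hB))

lemma Ex_union (p : E → ℝ) {F G : Finset E} (h : Disjoint F G) (g : Finset E → ℝ) :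
    Ex p (F ∪ G) g = Ex p F fun A => Ex p G fun B => g (A ∪ B) := by
  induction F using Finset.induction_on generalizing g with
  | empty => simp [Ex_empty]
  | insert e F he ih =>
    rw [Finset.disjoint_insert_left] at h
    rw [Finset.insert_union, Ex_insert p (by simp [he, h.1]), Ex_insert p he, ih h.2, ih h.2]
    simp only [Finset.insert_union]

/-- A function depending only on the edges satisfying `q` can be integrated over these edges. -/
lemma Ex_filter (p : E → ℝ) (F : Finset E) (q : E → Prop) [DecidablePred q] {g : Finset E → ℝ}
    (hg : ∀ B ⊆ F, g B = g (B.filter q)) : Ex p F g = Ex p (F.filter q) g := by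
  conv_lhs => rw [← Finset.filter_union_filter_not_eq q F]
  rw [Ex_union p (Finset.disjoint_filter_filter_not F F q)]
  refine Ex_congr fun A hA => ?_
  rw [Ex_congr (h := fun _ => g A), Ex_const]
  intro B hB
  have hA' : A.filter q = A := Finset.filter_true_of_mem fun e he =>
    (Finset.mem_filter.1 (hA he)).2
  have hB' : B.filter q = ∅ := Finset.filter_false_of_mem fun e he =>
    (Finset.mem_filter.1 (hB he)).2
  rw [hg (A ∪ B) (Finset.union_subset (hA.trans (Finset.filter_subset _ _))
    (hB.trans (Finset.filter_subset _ _))), Finset.filter_union, hA', hB', Finset.union_empty]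

lemma Ex_inter (p : E → ℝ) {F G : Finset E} (hGF : G ⊆ F) {g : Finset E → ℝ}
    (hg : ∀ B ⊆ F, g B = g (B ∩ G)) : Ex p F g = Ex p G g := by
  rw [Ex_filter p F (· ∈ G)]
  · congr 1
    ext e
    simpa using fun h => hGF h
  · intro B hB
    rw [hg B hB]
    congr 1

/-- Functions of complementary sets of edges are independent. -/
lemma Ex_mul_filter (p : E → ℝ) (F : Finset E) (q : E → Prop) [DecidablePred q] {g h : Finset E → ℝ}
    (hg : ∀ B ⊆ F, g B = g (B.filter q)) (hh : ∀ B ⊆ F, h B = h (B.filter fun e => ¬ q e)) :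
    Ex p F (fun B => g B * h B) = Ex p F g * Ex p F h := by
  rw [Ex_filter p F q (g := g) hg, Ex_filter p F (fun e => ¬ q e) (g := h) hh]
  conv_lhs => rw [← Finset.filter_union_filter_not_eq q F]
  rw [Ex_union p (Finset.disjoint_filter_filter_not F F q), mul_comm, ← Ex_const_mul]
  refine Ex_congr fun A hA => ?_
  rw [mul_comm, ← Ex_const_mul]
  refine Ex_congr fun B hB => ?_
  have hAF := hA.trans (Finset.filter_subset q F)
  have hBF := hB.trans (Finset.filter_subset _ F)
  have h1 : (A ∪ B).filter q = A.filter q := by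
    rw [Finset.filter_union, Finset.filter_false_of_mem (s := B) fun e he =>
      (Finset.mem_filter.1 (hB he)).2, Finset.union_empty]
  have h2 : (A ∪ B).filter (fun e => ¬ q e) = B.filter (fun e => ¬ q e) := by
    rw [Finset.filter_union, Finset.filter_false_of_mem (s := A) fun e he =>
      not_not.2 (Finset.mem_filter.1 (hA he)).2, Finset.empty_union]
  rw [hg _ (Finset.union_subset hAF hBF), hh _ (Finset.union_subset hAF hBF), h1, h2,
    ← hg A hAF, ← hh B hBF]

/-- The Harris inequality. -/
lemma Ex_mul_le_of_monotone {p : E → ℝ} (hp : ∀ e, p e ∈ Icc (0:ℝ) 1) (F : Finset E)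
    {g h : Finset E → ℝ} (hg : Monotone g) (hh : Monotone h) :
    Ex p F g * Ex p F h ≤ Ex p F fun B => g B * h B := by
  induction F using Finset.induction_on generalizing g h with
  | empty => simp [Ex_empty]
  | insert e F he ih =>
    have mono : ∀ {k : Finset E → ℝ}, Monotone k → Monotone fun B => k (insert e B) :=
      fun hk A B hAB => hk (Finset.insert_subset_insert e hAB)
    rw [Ex_insert p he, Ex_insert p he, Ex_insert p he]
    have h1 := ih (mono hg) (mono hh)
    have h0 := ih hg hh
    have hg' : Ex p F g ≤ Ex p F fun B => g (insert e B) :=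
      Ex_mono hp fun B _ => hg (Finset.subset_insert e B)
    have hh' : Ex p F h ≤ Ex p F fun B => h (insert e B) :=
      Ex_mono hp fun B _ => hh (Finset.subset_insert e B)
    obtain ⟨p0, p1⟩ := hp e
    have e1 := mul_le_mul_of_nonneg_left h1 p0
    have e0 := mul_le_mul_of_nonneg_left h0 (sub_nonneg.2 p1)
    nlinarith [mul_nonneg (mul_nonneg p0 (sub_nonneg.2 p1))
      (mul_nonneg (sub_nonneg.2 hg') (sub_nonneg.2 hh'))]

lemma Ex_le_Ex_of_subset {p : E → ℝ} (hp : ∀ e, p e ∈ Icc (0:ℝ) 1) {F G : Finset E}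
    (hFG : F ⊆ G) {g : Finset E → ℝ} (hg : Monotone g) : Ex p F g ≤ Ex p G g := by
  rw [← Finset.union_sdiff_of_subset hFG, Ex_union p Finset.disjoint_sdiff]
  refine Ex_mono hp fun A _ => ?_
  conv_lhs => rw [← Ex_const p (G \ F) (g A)]
  exact Ex_mono hp fun B _ => hg Finset.subset_union_left

/-- Monotonicity of expectations of increasing functions in the edge probabilities. -/
lemma Ex_le_Ex_of_le {p r : E → ℝ} (hp : ∀ e, p e ∈ Icc (0:ℝ) 1) (hr : ∀ e, r e ∈ Icc (0:ℝ) 1)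
    (hpr : ∀ e, p e ≤ r e) (F : Finset E) {g : Finset E → ℝ} (hg : Monotone g) :
    Ex p F g ≤ Ex r F g := by
  induction F using Finset.induction_on generalizing g with
  | empty => simp [Ex_empty]
  | insert e F he ih =>
    rw [Ex_insert p he, Ex_insert r he]
    have h1 := ih (g := fun B => g (insert e B))
      fun A B hAB => hg (Finset.insert_subset_insert e hAB)
    have h0 := ih hg
    have hg' : Ex r F g ≤ Ex r F fun B => g (insert e B) :=
      Ex_mono hr fun B _ => hg (Finset.subset_insert e B)
    obtain ⟨p0, p1⟩ := hp e
    nlinarith [mul_le_mul_of_nonneg_left h1 p0, mul_le_mul_of_nonneg_left h0 (sub_nonneg.2 p1),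
      mul_nonneg (sub_nonneg.2 (hpr e)) (sub_nonneg.2 hg')]

/-- Functions of disjoint finite sets of edges are independent. -/
lemma Ex_prod_biUnion {ι : Type*} (p : E → ℝ) (s : Finset ι) (F : ι → Finset E)
    (hF : (s : Set ι).PairwiseDisjoint F) (g : ι → Finset E → ℝ)
    (hg : ∀ i ∈ s, ∀ B, g i B = g i (B ∩ F i)) :
    Ex p (s.biUnion F) (fun B => ∏ i ∈ s, g i B) = ∏ i ∈ s, Ex p (F i) (g i) := by
  induction s using Finset.induction_on with
  | empty => simp [Ex_empty]
  | insert i s hi ih =>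
    have hs : (s : Set ι).PairwiseDisjoint F := hF.subset (by simp)
    have hdisj : ∀ j ∈ s, Disjoint (F i) (F j) := fun j hj =>
      hF (by simp) (by simp [hj]) fun h => hi (h ▸ hj)
    rw [Finset.prod_insert hi, ← ih hs fun j hj => hg j (Finset.mem_insert_of_mem hj)]
    simp only [Finset.prod_insert hi]
    rw [Ex_mul_filter p _ (· ∈ F i)]
    · congr 1
      · refine Ex_inter p (by simp) fun B _ => hg i (by simp) B
      · refine Ex_inter p (by simp) fun B _ => Finset.prod_congr rfl fun j hj => ?_
        rw [hg j (by simp [hj]) B, hg j (by simp [hj]) (B ∩ s.biUnion F), Finset.inter_assoc,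
          Finset.inter_eq_right.2 (Finset.subset_biUnion_of_mem F hj)]
    · intro B _
      rw [hg i (by simp) B]
      congr 1
    · intro B _
      refine Finset.prod_congr rfl fun j hj => ?_
      rw [hg j (by simp [hj]) B, hg j (by simp [hj]) (B.filter _)]
      congr 1
      ext e
      have := fun h : e ∈ F j => Finset.disjoint_right.1 (hdisj j hj) h
      simp only [Finset.mem_inter, Finset.mem_filter]
      tauto

/-- Russo's formula. -/
lemma hasDerivAt_Ex {p : ℝ → E → ℝ} {p' : E → ℝ} {t : ℝ}
    (hp : ∀ e, HasDerivAt (fun s => p s e) (p' e) t) (F : Finset E) (g : Finset E → ℝ) :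
    HasDerivAt (fun s => Ex (p s) F g)
      (∑ e ∈ F, p' e * Ex (p t) (F.erase e) fun B => g (insert e B) - g B) t := by
  induction F using Finset.induction_on generalizing g with
  | empty => simpa [Ex_empty] using hasDerivAt_const t (g ∅)
  | insert e F he ih =>
    have h1 := ((hp e).mul (ih fun B => g (insert e B))).add
      (((hasDerivAt_const t (1:ℝ)).sub (hp e)).mul (ih g))
    have h2 : (fun s => Ex (p s) (insert e F) g) =
        ((fun s => p s e) * fun s => Ex (p s) F fun B => g (insert e B)) +
          ((fun _ => (1:ℝ)) - fun s => p s e) * fun s => Ex (p s) F g := by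
      ext s
      simp [Ex_insert (p s) he]
    rw [h2]
    refine h1.congr_deriv ?_
    have h3 : ∀ a ∈ F, p' a * Ex (p t) ((insert e F).erase a) (fun B => g (insert a B) - g B) =
        p t e * (p' a * Ex (p t) (F.erase a) fun B => g (insert e (insert a B)) - g (insert e B)) +
        (1 - p t e) * (p' a * Ex (p t) (F.erase a) fun B => g (insert a B) - g B) := by
      intro a ha
      have hae : e ≠ a := fun h => he (h ▸ ha)
      rw [Finset.erase_insert_of_ne hae, Ex_insert _ (by simp [he])]
      simp only [Finset.insert_comm a e]
      ring
    rw [Finset.sum_insert he, Finset.erase_insert he, Finset.sum_congr rfl h3,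
      Finset.sum_add_distrib, ← Finset.mul_sum, ← Finset.mul_sum, Ex_sub]
    simp only [Pi.sub_apply]
    ring

/-- Expectations over one fewer edge. -/
lemma mul_Ex_erase (p : E → ℝ) {e : E} {F : Finset E} (he : e ∈ F) (g : Finset E → ℝ) :
    (1 - p e) * Ex p (F.erase e) g = Ex p F fun B => if e ∈ B then 0 else g B := by
  conv_rhs => rw [← Finset.insert_erase he]
  rw [Ex_insert p (Finset.notMem_erase e F)]
  have h1 : Ex p (F.erase e) (fun B => if e ∈ insert e B then 0 else g (insert e B)) = 0 := by
    simpa using Ex_const p (F.erase e) 0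
  rw [h1, mul_zero, zero_add]
  congr 1
  refine Ex_congr fun B hB => ?_
  rw [if_neg fun h => Finset.notMem_erase e F (hB h)]

end Expectation

section Clusters

open scoped Classical

variable {E : Type} {L : LatticeOn E}

/-- `e` joins `a` to `b`. -/
def Joins (L : LatticeOn E) (e : E) (a b : Pt) : Prop := L.ends e = (a, b) ∨ L.ends e = (b, a)

/-- `a` and `b` are vertices in `S` joined by an edge in `O`. -/
def AdjIn (L : LatticeOn E) (O : Set E) (S : Set Pt) (a b : Pt) : Prop :=
  ∃ e ∈ O, Joins L e a b ∧ a ∈ S ∧ b ∈ S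

/-- The set of points joined to `v` by paths in `S` with edges in `O`. -/
def cl (L : LatticeOn E) (O : Set E) (S : Set Pt) (v : Pt) : Set Pt :=
  {u | Relation.ReflTransGen (AdjIn L O S) v u}

/-- Both endpoints of `e` lie in `S`. -/
def Inside (L : LatticeOn E) (S : Set Pt) (e : E) : Prop := (L.ends e).1 ∈ S ∧ (L.ends e).2 ∈ S

/-- Some endpoint of `e` lies in `S`. -/
def Touches (L : LatticeOn E) (S : Set Pt) (e : E) : Prop := (L.ends e).1 ∈ S ∨ (L.ends e).2 ∈ S

/-- Exactly one endpoint of `e` lies in `S`. -/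
def Bdry (L : LatticeOn E) (S : Set Pt) (e : E) : Prop :=
  ((L.ends e).1 ∈ S ∧ (L.ends e).2 ∉ S) ∨ ((L.ends e).1 ∉ S ∧ (L.ends e).2 ∈ S)

/-- The endpoint in `S` of an edge in the boundary of `S`. -/
noncomputable def inn (L : LatticeOn E) (S : Set Pt) (e : E) : Pt :=
  if (L.ends e).1 ∈ S then (L.ends e).1 else (L.ends e).2

/-- The endpoint outside `S` of an edge in the boundary of `S`. -/
noncomputable def out (L : LatticeOn E) (S : Set Pt) (e : E) : Pt :=
  if (L.ends e).1 ∈ S then (L.ends e).2 else (L.ends e).1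

lemma Joins.symm {e : E} {a b : Pt} (h : Joins L e a b) : Joins L e b a := Or.symm h

lemma AdjIn.symm {O : Set E} {S : Set Pt} {a b : Pt} (h : AdjIn L O S a b) : AdjIn L O S b a :=
  let ⟨e, he, hj, ha, hb⟩ := h
  ⟨e, he, hj.symm, hb, ha⟩

lemma mem_cl_self (O : Set E) (S : Set Pt) (v : Pt) : v ∈ cl L O S v := .refl

lemma cl_mono {O O' : Set E} (h : O ⊆ O') {S S' : Set Pt} (hS : S ⊆ S') (v : Pt) :
    cl L O S v ⊆ cl L O' S' v := fun _ hu =>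
  Relation.ReflTransGen.mono (fun _ _ ⟨e, he, hj, ha, hb⟩ => ⟨e, h he, hj, hS ha, hS hb⟩) _ _ hu

lemma cl_step {O : Set E} {S : Set Pt} {v a b : Pt} (ha : a ∈ cl L O S v)
    (h : AdjIn L O S a b) : b ∈ cl L O S v := Relation.ReflTransGen.tail ha h

lemma cl_subset_of_closed {O : Set E} {S X : Set Pt} {v : Pt} (hv : v ∈ X)
    (h : ∀ a b, a ∈ X → AdjIn L O S a b → b ∈ X) : cl L O S v ⊆ X := fun u hu => by
  induction hu with
  | refl => exact hv
  | tail _ hab ih => exact h _ _ ih hab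

lemma cl_symm {O : Set E} {S : Set Pt} {a b : Pt} (h : b ∈ cl L O S a) : a ∈ cl L O S b := by
  induction h with
  | refl => exact mem_cl_self _ _ _
  | tail _ hbc ih => exact Relation.ReflTransGen.head hbc.symm ih

lemma Joins.touches {e : E} {a b : Pt} (h : Joins L e a b) {S : Set Pt} (ha : a ∈ S) :
    Touches L S e := by
  rcases h with h | h <;> simp [Touches, h, ha]

lemma Joins.inside {e : E} {a b : Pt} (h : Joins L e a b) {S : Set Pt} :
    Inside L S e ↔ a ∈ S ∧ b ∈ S := by
  rcases h with h | h <;> simp [Inside, h, and_comm]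

lemma Joins.bdry {e : E} {a b : Pt} (h : Joins L e a b) {S : Set Pt} (ha : a ∈ S) (hb : b ∉ S) :
    Bdry L S e ∧ inn L S e = a ∧ out L S e = b := by
  rcases h with h | h <;> simp [Bdry, inn, out, h, ha, hb]

lemma Bdry.joins {e : E} {S : Set Pt} (h : Bdry L S e) :
    Joins L e (inn L S e) (out L S e) ∧ inn L S e ∈ S ∧ out L S e ∉ S := by
  rcases h with h | h <;> simp [inn, out, h, Joins]

lemma Bdry.not_inside {e : E} {S : Set Pt} (h : Bdry L S e) : ¬ Inside L S e := by
  unfold Bdry at h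
  unfold Inside
  tauto

lemma Bdry.touches {e : E} {S : Set Pt} (h : Bdry L S e) : Touches L S e := by
  unfold Bdry at h
  unfold Touches
  tauto

lemma cl_filter_inside (B : Finset E) (S : Set Pt) (v : Pt) :
    cl L (B.filter (Inside L S) : Finset E) S v = cl L B S v := by
  refine Subset.antisymm (cl_mono (fun e he => by
    simp only [Finset.coe_filter, mem_ofPred_eq] at he
    exact he.1) subset_rfl v) ?_
  refine cl_subset_of_closed (mem_cl_self _ _ _) fun a b ha ⟨e, he, hj, haS, hbS⟩ =>
    cl_step ha ⟨e, ?_, hj, haS, hbS⟩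
  simpa using ⟨he, hj.inside.2 ⟨haS, hbS⟩⟩

/-- `x` is joined by edges in `B` to a point outside `Λ`. -/
def Reach (L : LatticeOn E) (Λ : Finset Pt) (B : Finset E) (x : Pt) : Prop :=
  ∃ u ∉ Λ, u ∈ cl L B univ x

/-- The points of `Λ` not joined to the complement of `Λ`. -/
noncomputable def trapped (L : LatticeOn E) (Λ : Finset Pt) (B : Finset E) : Finset Pt :=
  Λ.filter fun x => ¬ Reach L Λ B x

lemma Reach.mono {Λ : Finset Pt} {B B' : Finset E} (h : B ⊆ B') {x : Pt} (hx : Reach L Λ B x) :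
    Reach L Λ B' x :=
  let ⟨u, hu, hux⟩ := hx
  ⟨u, hu, cl_mono (by exact_mod_cast h) subset_rfl _ hux⟩

lemma Reach.of_adj {Λ : Finset Pt} {B : Finset E} {x y : Pt} (h : AdjIn L B univ x y)
    (hy : Reach L Λ B y) : Reach L Λ B x :=
  let ⟨u, hu, huy⟩ := hy
  ⟨u, hu, Relation.ReflTransGen.head h huy⟩

lemma reach_of_notMem_trapped {Λ : Finset Pt} {B : Finset E} {y : Pt}
    (hy : y ∉ trapped L Λ B) : Reach L Λ B y := by
  by_cases h : y ∈ Λ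
  · by_contra hc
    exact hy (by simp [trapped, h, hc])
  · exact ⟨y, h, mem_cl_self _ _ _⟩

lemma not_reach_of_mem_trapped {Λ : Finset Pt} {B : Finset E} {y : Pt}
    (hy : y ∈ trapped L Λ B) : ¬ Reach L Λ B y := by
  simp only [trapped, Finset.mem_filter] at hy
  exact hy.2

lemma notMem_of_bdry_trapped {Λ : Finset Pt} {B : Finset E} {e : E}
    (he : Bdry L (trapped L Λ B : Finset Pt) e) : e ∉ B := fun heB => by
  obtain ⟨hj, hi, ho⟩ := he.joins
  exact not_reach_of_mem_trapped hi
    ((reach_of_notMem_trapped ho).of_adj ⟨e, heB, hj, mem_univ _, mem_univ _⟩)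

lemma reach_insert_of_bdry_trapped {Λ : Finset Pt} {B : Finset E} {e : E} {v : Pt}
    (he : Bdry L (trapped L Λ B : Finset Pt) e)
    (hv : inn L (trapped L Λ B : Finset Pt) e ∈ cl L B (trapped L Λ B : Finset Pt) v) :
    Reach L Λ (insert e B) v := by
  obtain ⟨hj, hi, ho⟩ := he.joins
  obtain ⟨u, hu, hou⟩ := (reach_of_notMem_trapped ho).mono (Finset.subset_insert e B)
  refine ⟨u, hu, Relation.ReflTransGen.trans ?_ (Relation.ReflTransGen.head
    ⟨e, by simp, hj, mem_univ _, mem_univ _⟩ hou)⟩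
  exact cl_mono (by simp) (subset_univ _) v hv

/-- Whether `S` is the trapped set depends only on the edges not inside `S`. -/
lemma trapped_eq_of_agree {Λ S : Finset Pt} {B B' : Finset E} (h : trapped L Λ B = S)
    (hag : ∀ e, ¬ Inside L (S : Set Pt) e → (e ∈ B ↔ e ∈ B')) : trapped L Λ B' = S := by
  have hin : ∀ x ∈ S, ¬ Reach L Λ B' x := by
    rintro x hx ⟨u, hu, hux⟩
    have hsub : cl L (B' : Set E) univ x ⊆ S := by
      refine cl_subset_of_closed hx fun a b ha ⟨e, he, hj, _, _⟩ => ?_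
      by_contra hb
      have hbd := (hj.bdry ha hb).1
      refine notMem_of_bdry_trapped (Λ := Λ) (B := B) (by rwa [h]) ((hag e hbd.not_inside).2 he)
    have := hsub hux
    rw [← h] at this
    exact hu (Finset.mem_filter.1 this).1
  have hout : ∀ x ∈ Λ, x ∉ S → Reach L Λ B' x := by
    intro x _ hxS
    rw [← h] at hxS
    obtain ⟨u, hu, hux⟩ := reach_of_notMem_trapped hxS
    refine ⟨u, hu, ?_⟩
    clear hxS
    have : ∀ y, Relation.ReflTransGen (AdjIn L (B : Set E) univ) y u → y ∈ cl L B' univ u := by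
      intro y hy
      induction hy using Relation.ReflTransGen.head_induction_on with
      | refl => exact mem_cl_self _ _ _
      | @head a c hac hcu ih =>
        obtain ⟨e, he, hj, -, -⟩ := hac
        refine cl_step ih ⟨e, (hag e fun hins => ?_).1 he, hj.symm, mem_univ _, mem_univ _⟩
        have haS := (hj.inside.1 hins).2
        rw [← h] at haS
        exact not_reach_of_mem_trapped haS ⟨u, hu, hcu⟩
    have hsymm : ∀ y z, y ∈ cl L (B' : Set E) univ z → z ∈ cl L (B' : Set E) univ y :=
      fun y z hyz => cl_symm hyz
    exact hsymm _ _ (this x hux)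
  ext x
  simp only [trapped, Finset.mem_filter]
  constructor
  · rintro ⟨hx, hr⟩
    by_contra hxS
    exact hr (hout x hx hxS)
  · intro hx
    refine ⟨?_, hin x hx⟩
    rw [← h] at hx
    exact (Finset.mem_filter.1 hx).1

lemma trapped_eq_filter_iff (Λ S : Finset Pt) (B : Finset E) :
    trapped L Λ B = S ↔ trapped L Λ (B.filter fun e => ¬ Inside L (S : Set Pt) e) = S :=
  ⟨fun h => trapped_eq_of_agree h fun e he => by simp [he],
    fun h => trapped_eq_of_agree h fun e he => by simp [he]⟩

end Clusters

section Sharpness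

open scoped Classical

variable {E : Type} {L : LatticeOn E}

lemma monotone_ite {α : Type*} [Preorder α] {P : α → Prop} (h : ∀ ⦃a b⦄, a ≤ b → P a → P b) :
    Monotone fun a => if P a then (1:ℝ) else 0 := fun a b hab => by
  by_cases ha : P a
  · simp [ha, h hab ha]
  · simp only [ha, if_false]
    split_ifs <;> norm_num

/-- A lower bound for the derivative in Russo's formula for the event that `v` is joined to the
complement of `Λ`. -/
lemma le_sum_influence {Λ : Finset Pt} {v : Pt} (hv : v ∈ Λ) (F : Finset E) {r Δ : E → ℝ} {c : ℝ}
    (hr : ∀ e, r e ∈ Icc (0:ℝ) 1) (hΔ : ∀ e, 0 ≤ Δ e)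
    (h : ∀ S ⊆ Λ, v ∈ S → (∀ e ∈ F, Bdry L (S : Set Pt) e → r e ≠ 1) →
      c ≤ ∑ e ∈ F.filter (Bdry L (S : Set Pt)),
        Δ e * Ex r F fun B => if inn L S e ∈ cl L B S v then 1 else 0) :
    c * (1 - Ex r F fun B => if Reach L Λ B v then 1 else 0) ≤
      ∑ e ∈ F, Δ e * Ex r (F.erase e) fun B =>
        (if Reach L Λ (insert e B) v then 1 else 0) - (if Reach L Λ B v then 1 else 0) := by
  set g : Finset E → ℝ := fun B => if Reach L Λ B v then 1 else 0 with hg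
  have gmono : Monotone g := monotone_ite fun A B hAB => Reach.mono hAB
  set 𝒮 := Λ.powerset.filter (v ∈ ·) with h𝒮
  have step1 : Ex r F (fun B => ∑ S ∈ 𝒮, ∑ e ∈ F.filter (Bdry L (S : Set Pt)),
      Δ e * ((if inn L S e ∈ cl L B S v then 1 else 0) * if trapped L Λ B = S then 1 else 0)) ≤
      ∑ e ∈ F, Δ e * Ex r (F.erase e) fun B => g (insert e B) - g B := by
    calc _ ≤ Ex r F (fun B => ∑ e ∈ F, Δ e * if e ∈ B then 0 else g (insert e B) - g B) := by
          refine Ex_mono hr fun B _ => ?_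
          have hnn : ∀ e ∈ F, 0 ≤ Δ e * if e ∈ B then 0 else g (insert e B) - g B := by
            intro e _
            refine mul_nonneg (hΔ e) ?_
            split_ifs
            · exact le_rfl
            · exact sub_nonneg.2 (gmono (Finset.subset_insert e B))
          have hzero : ∀ S ∈ 𝒮, S ≠ trapped L Λ B → ∑ e ∈ F.filter (Bdry L (S : Set Pt)),
              Δ e * ((if inn L S e ∈ cl L B S v then 1 else 0) *
                if trapped L Λ B = S then 1 else 0) = 0 := by
            intro S _ hS
            simp [Ne.symm hS]
          by_cases hvt : trapped L Λ B ∈ 𝒮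
          · rw [Finset.sum_eq_single_of_mem _ hvt hzero]
            have hvt' : v ∈ trapped L Λ B := (Finset.mem_filter.1 hvt).2
            refine (Finset.sum_le_sum fun e he => ?_).trans
              (Finset.sum_le_sum_of_subset_of_nonneg (Finset.filter_subset _ F)
                fun e he _ => hnn e he)
            refine mul_le_mul_of_nonneg_left ?_ (hΔ e)
            have hb := (Finset.mem_filter.1 he).2
            rw [if_neg (notMem_of_bdry_trapped hb), if_pos rfl, mul_one]
            split_ifs with hc
            · simp [hg, reach_insert_of_bdry_trapped hb hc, not_reach_of_mem_trapped hvt']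
            · exact sub_nonneg.2 (gmono (Finset.subset_insert e B))
          · rw [Finset.sum_eq_zero fun S hS => hzero S hS fun h => hvt (h ▸ hS)]
            exact Finset.sum_nonneg hnn
      _ = ∑ e ∈ F, Δ e * ((1 - r e) * Ex r (F.erase e) fun B => g (insert e B) - g B) := by
          rw [Ex_sum]
          refine Finset.sum_congr rfl fun e he => ?_
          rw [Ex_const_mul, mul_Ex_erase r he]
      _ ≤ _ := by
          refine Finset.sum_le_sum fun e _ => mul_le_mul_of_nonneg_left ?_ (hΔ e)
          have : 0 ≤ Ex r (F.erase e) fun B => g (insert e B) - g B :=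
            Ex_nonneg hr fun B _ => sub_nonneg.2 (gmono (Finset.subset_insert e B))
          nlinarith [(hr e).1]
  refine le_trans ?_ step1
  have hind : ∀ S : Finset Pt, ∀ e,
      Ex r F (fun B => (if inn L S e ∈ cl L B S v then (1:ℝ) else 0) *
        if trapped L Λ B = S then 1 else 0) =
      Ex r F (fun B => if inn L S e ∈ cl L B S v then 1 else 0) *
        Ex r F (fun B => if trapped L Λ B = S then 1 else 0) := by
    intro S e
    refine Ex_mul_filter r F (Inside L (S : Set Pt)) (fun B _ => ?_) (fun B _ => ?_)
    · rw [cl_filter_inside]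
    · exact if_congr (trapped_eq_filter_iff Λ S B) rfl rfl
  calc c * (1 - Ex r F g)
      = ∑ S ∈ 𝒮, c * Ex r F (fun B => if trapped L Λ B = S then 1 else 0) := by
        have h1 : 1 - Ex r F g = Ex r F fun B => 1 - g B := by rw [Ex_sub, Ex_const]
        rw [← Finset.mul_sum, ← Ex_sum, h1]
        congr 1
        refine Ex_congr fun B _ => ?_
        rw [Finset.sum_ite_eq]
        by_cases hB : Reach L Λ B v
        · simp [h𝒮, hg, trapped, hB]
        · simp [h𝒮, hg, trapped, hB, hv]
    _ ≤ ∑ S ∈ 𝒮, (∑ e ∈ F.filter (Bdry L (S : Set Pt)),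
          Δ e * Ex r F fun B => if inn L S e ∈ cl L B S v then 1 else 0) *
          Ex r F (fun B => if trapped L Λ B = S then 1 else 0) := by
        refine Finset.sum_le_sum fun S hS => ?_
        have hS' := Finset.mem_filter.1 hS
        by_cases hall : ∀ e ∈ F, Bdry L (S : Set Pt) e → r e ≠ 1
        · refine mul_le_mul_of_nonneg_right (h S (Finset.mem_powerset.1 hS'.1) hS'.2 hall) ?_
          exact Ex_nonneg hr fun B _ => by split_ifs <;> norm_num
        · push Not at hall
          obtain ⟨e, he, hb, hre⟩ := hall
          have hz : Ex r F (fun B => if trapped L Λ B = S then 1 else 0) = 0 := by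
            refine le_antisymm ?_ (Ex_nonneg hr fun B _ => by split_ifs <;> norm_num)
            have h1 := mul_Ex_erase r he fun _ => 1
            rw [hre, sub_self, zero_mul] at h1
            refine le_trans ?_ h1.ge
            refine Ex_mono hr fun B _ => ?_
            by_cases hB : trapped L Λ B = S
            · rw [if_neg (notMem_of_bdry_trapped (Λ := Λ) (by rwa [hB]))]
              split_ifs <;> norm_num
            · rw [if_neg hB]
              split_ifs <;> norm_num
          rw [hz, mul_zero, mul_zero]
    _ = _ := by
        rw [Ex_sum]
        refine Finset.sum_congr rfl fun S _ => ?_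
        rw [Ex_sum, Finset.sum_mul]
        refine Finset.sum_congr rfl fun e _ => ?_
        rw [Ex_const_mul, hind, mul_assoc]

/-- If the expected number of open exits is at least `1/2` for every set of vertices containing
`v` within `Λ`, at intensities `pu`, then the probability that `v` is joined to the complement of
`Λ` at the larger intensities `p` is bounded from below. -/
lemma le_reach_of_exits {Λ : Finset Pt} {v : Pt} (hv : v ∈ Λ) (F : Finset E) {p pu : E → ℝ}
    {c : ℝ} (hc : 0 ≤ c) (hp : ∀ e, p e ∈ Icc (0:ℝ) 1) (hpu : ∀ e, pu e ∈ Icc (0:ℝ) 1)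
    (hle : ∀ e, pu e ≤ p e) (hone : ∀ e, p e = 1 → pu e = 1)
    (hgap : ∀ e, p e ≠ 1 → c * p e ≤ p e - pu e)
    (h : ∀ S ⊆ Λ, v ∈ S → 1 / 2 ≤ ∑ e ∈ F.filter (Bdry L (S : Set Pt)),
        pu e * Ex pu F fun B => if inn L S e ∈ cl L B S v then 1 else 0) :
    c / 2 * (1 - Ex p F fun B => if Reach L Λ B v then 1 else 0) ≤
      Ex p F fun B => if Reach L Λ B v then 1 else 0 := by
  set g : Finset E → ℝ := fun B => if Reach L Λ B v then 1 else 0 with hg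
  have gmono : Monotone g := monotone_ite fun A B hAB => Reach.mono hAB
  set q : ℝ → E → ℝ := fun t e => pu e + t * (p e - pu e) with hq
  have hder : ∀ t e, HasDerivAt (fun s => q s e) (p e - pu e) t := fun t e => by
    simpa [hq] using ((hasDerivAt_id t).mul_const (p e - pu e)).const_add (pu e)
  have hD := fun t => hasDerivAt_Ex (hder t) F g
  obtain ⟨t, ht, hmv⟩ := exists_hasDerivAt_eq_slope (fun s => Ex (q s) F g) _ zero_lt_one
    (fun t _ => (hD t).continuousAt.continuousWithinAt) fun t _ => hD t
  have hq1 : q 1 = p := by ext e; simp [hq]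
  have hq0 : q 0 = pu := by ext e; simp [hq]
  have hqle : ∀ e, q t e ≤ p e := fun e => by
    have := hle e
    simp only [hq]; nlinarith [ht.2]
  have hqge : ∀ e, pu e ≤ q t e := fun e => by
    have := hle e
    simp only [hq]; nlinarith [ht.1]
  have hqI : ∀ e, q t e ∈ Icc (0:ℝ) 1 := fun e =>
    ⟨(hpu e).1.trans (hqge e), (hqle e).trans (hp e).2⟩
  have hkey := le_sum_influence (L := L) hv F (c := c / 2) hqI
    (fun e => sub_nonneg.2 (hle e)) (by
      intro S hS hvS hb
      calc c / 2 = c * (1 / 2) := by ring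
        _ ≤ c * ∑ e ∈ F.filter (Bdry L (S : Set Pt)),
            pu e * Ex pu F fun B => if inn L S e ∈ cl L B S v then 1 else 0 :=
          mul_le_mul_of_nonneg_left (h S hS hvS) hc
        _ ≤ _ := by
          rw [Finset.mul_sum]
          refine Finset.sum_le_sum fun e he => ?_
          rw [← mul_assoc]
          have he' := Finset.mem_filter.1 he
          have hpe : p e ≠ 1 := fun hpe => hb e he'.1 he'.2 (by simp [hq, hpe, hone e hpe])
          have hm : Monotone fun B : Finset E =>
              if inn L (S : Set Pt) e ∈ cl L (B : Set E) S v then (1:ℝ) else 0 :=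
            monotone_ite fun A B hAB h => cl_mono (by exact_mod_cast hAB) subset_rfl v h
          refine mul_le_mul ?_ (Ex_le_Ex_of_le hpu hqI hqge F hm)
            (Ex_nonneg hpu fun B _ => by split_ifs <;> norm_num) (sub_nonneg.2 (hle e))
          exact (mul_le_mul_of_nonneg_left (hle e) hc).trans (hgap e hpe))
  have h1 : Ex (q t) F g ≤ Ex p F g := Ex_le_Ex_of_le hqI hp hqle F gmono
  have h0 : 0 ≤ Ex pu F g := Ex_nonneg hpu fun B _ => by
    simp only [hg]; split_ifs <;> norm_num
  rw [hq1, hq0, sub_zero, div_one] at hmv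
  have h2 : c / 2 * (1 - Ex p F g) ≤ c / 2 * (1 - Ex (q t) F g) :=
    mul_le_mul_of_nonneg_left (by linarith) (by linarith)
  linarith [hkey.trans_eq hmv]

end Sharpness

section Branching

open scoped Classical

variable {E : Type} {L : LatticeOn E}

/-- The number of edges of `B` leaving `S` from the cluster of `q` in `S`. -/
noncomputable def exits (L : LatticeOn E) (S : Set Pt) (q : Pt) (B : Finset E) : Finset E :=
  B.filter fun e => Bdry L S e ∧ inn L S e ∈ cl L B S q

lemma exits_mono (S : Set Pt) (q : Pt) {B B' : Finset E} (h : B ⊆ B') :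
    exits L S q B ⊆ exits L S q B' := fun e he => by
  obtain ⟨heB, hb, hi⟩ := Finset.mem_filter.1 he
  exact Finset.mem_filter.2 ⟨h heB, hb, cl_mono (by exact_mod_cast h) subset_rfl _ hi⟩

lemma finite_cl (B : Finset E) (S : Set Pt) (q : Pt) : (cl L B S q).Finite := by
  refine ((B.finite_toSet.image fun e => (L.ends e).1).union
    ((B.finite_toSet.image fun e => (L.ends e).2).union (finite_singleton q))).subset ?_
  refine cl_subset_of_closed (by simp) fun a b _ ⟨e, he, hj, _, _⟩ => ?_
  rcases hj with hj | hj
  · exact Or.inr (Or.inl ⟨e, he, by simp [hj]⟩)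
  · exact Or.inl ⟨e, he, by simp [hj]⟩

lemma finite_biUnion_cl (B : Finset E) (S : Set Pt) (Q : Finset Pt) :
    (⋃ q ∈ Q, cl L B S q).Finite :=
  Q.finite_toSet.biUnion fun q _ => finite_cl B S q

lemma cl_subset {O : Set E} {S : Set Pt} {q : Pt} (hq : q ∈ S) : cl L O S q ⊆ S :=
  cl_subset_of_closed hq fun _ _ _ ⟨_, _, _, _, hb⟩ => hb

lemma cl_union_eq_iff {S : Set Pt} {q : Pt} {T : Set Pt} {A B : Finset E}
    (hB : ∀ e ∈ B, ¬ Touches L T e) :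
    cl L (A ∪ B : Finset E) S q = T ↔ cl L A S q = T := by
  have hsub : cl L A S q ⊆ cl L (A ∪ B : Finset E) S q :=
    cl_mono (by simp) subset_rfl q
  have key : ∀ {e a b}, a ∈ T → e ∈ ((A ∪ B : Finset E) : Set E) → Joins L e a b → e ∈ A := by
    intro e a b ha he hj
    rcases Finset.mem_union.1 (Finset.mem_coe.1 he) with he | he
    · exact he
    · exact absurd (hj.touches ha) (hB e he)
  constructor
  · intro h
    refine Subset.antisymm (h ▸ hsub) ?_
    rw [← h]
    refine (cl_subset_of_closed (X := {u | u ∈ cl L A S q ∧ u ∈ cl L (A ∪ B : Finset E) S q})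
      ⟨mem_cl_self _ _ _, mem_cl_self _ _ _⟩ ?_).trans fun u hu => hu.1
    rintro a b ⟨ha, ha'⟩ hab
    refine ⟨?_, cl_step ha' hab⟩
    obtain ⟨e, he, hj, haS, hbS⟩ := hab
    exact cl_step ha ⟨e, key (h ▸ ha') he hj, hj, haS, hbS⟩
  · intro h
    refine Subset.antisymm ?_ (h ▸ hsub)
    refine cl_subset_of_closed (h ▸ mem_cl_self _ _ _) ?_
    rintro a b ha ⟨e, he, hj, haS, hbS⟩
    rw [← h]
    exact cl_step (h.symm ▸ ha) ⟨e, key ha he hj, hj, haS, hbS⟩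

lemma biUnion_cl_subset {T : Set Pt} {q : Pt} {Q : Finset Pt} {A B : Finset E}
    (hqT : q ∈ T) (hA : ∀ e ∈ A, Touches L T e) (hB : ∀ e ∈ B, ¬ Touches L T e) :
    (⋃ u ∈ Q, cl L (A ∪ B : Finset E) univ u) ⊆
      T ∪ ⋃ u ∈ Q.erase q ∪ (A.filter (Bdry L T)).image (out L T), cl L B univ u := by
  refine iUnion₂_subset fun u hu => cl_subset_of_closed ?_ ?_
  · by_cases huq : u = q
    · exact Or.inl (huq ▸ hqT)
    · refine Or.inr (mem_iUnion₂.2 ⟨u, ?_, mem_cl_self _ _ _⟩)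
      simp [huq, hu]
  · rintro a b ha ⟨e, he, hj, -, -⟩
    by_cases hbT : b ∈ T
    · exact Or.inl hbT
    by_cases haT : a ∈ T
    · have heA : e ∈ A := by
        rcases Finset.mem_union.1 (Finset.mem_coe.1 he) with he | he
        · exact he
        · exact absurd (hj.touches haT) (hB e he)
      refine Or.inr (mem_iUnion₂.2 ⟨b, ?_, mem_cl_self _ _ _⟩)
      obtain ⟨h1, -, h3⟩ := hj.bdry haT hbT
      exact Finset.mem_union_right _ (Finset.mem_image.2 ⟨e, Finset.mem_filter.2 ⟨heA, h1⟩, h3⟩)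
    · have heB : e ∈ B := by
        rcases Finset.mem_union.1 (Finset.mem_coe.1 he) with he | he
        · exfalso
          rcases hj with hj | hj <;> rcases hA e he with h | h <;> rw [hj] at h
          exacts [haT h, hbT h, hbT h, haT h]
        · exact he
      rcases ha with ha | ha
      · exact absurd ha haT
      obtain ⟨u, hu, hau⟩ := mem_iUnion₂.1 ha
      exact Or.inr (mem_iUnion₂.2 ⟨u, hu, cl_step hau ⟨e, heB, hj, mem_univ _, mem_univ _⟩⟩)

lemma one_add_pow_le {x : ℝ} (hx : 0 ≤ x) (n : ℕ) (hn : n * x ≤ 1 / 2) :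
    (1 + x) ^ n ≤ 1 + 3 / 2 * x * n := by
  have key : ∀ m ≤ n, (1 + x) ^ m ≤ 1 + m * x + (m * x) ^ 2 := by
    intro m hm
    induction m with
    | zero => simp
    | succ m ih =>
      have hmn : (m:ℝ) * x ≤ 1 / 2 :=
        (mul_le_mul_of_nonneg_right (Nat.cast_le.2 (by omega)) hx).trans hn
      have hm0 : (0:ℝ) ≤ m := m.cast_nonneg
      rw [pow_succ]
      push_cast
      have h1 := mul_le_mul_of_nonneg_right (ih (by omega)) (show 0 ≤ 1 + x by linarith)
      have h2 := mul_le_mul_of_nonneg_left hmn (show 0 ≤ m * x ^ 2 by positivity)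
      have h3 : 0 ≤ m * x ^ 2 := by positivity
      nlinarith [sq_nonneg x]
  have h0 : 0 ≤ n * x := by positivity
  nlinarith [key n le_rfl]

/-- If the cluster of each point `q` within a bounded set `S q` has at most `1/2` open exits on
average, the volume of the open cluster has an exponential moment. -/
lemma exp_moment_le {p : E → ℝ} (hp : ∀ e, p e ∈ Icc (0:ℝ) 1) {a x : ℝ} {M D : ℕ} (ha : 1 ≤ a)
    (hx : 0 ≤ x) (hDx : D * x ≤ 1 / 2) (haM : a ^ M * (1 + 3 / 4 * x) ≤ 1 + x)
    (S : Pt → Finset Pt) (hS : ∀ q, q ∈ S q) (hM : ∀ q, (S q).card ≤ M)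
    (hD : ∀ q (G : Finset E), (G.filter (Touches L (S q : Set Pt))).card ≤ D)
    (hN : ∀ q (G : Finset E), Ex p G (fun B => ((exits L (S q) q B).card : ℝ)) ≤ 1 / 2)
    (K : ℕ) (G : Finset E) (Q : Finset Pt) :
    Ex p G (fun B => a ^ min (⋃ q ∈ Q, cl L B univ q).ncard K) ≤ (1 + x) ^ Q.card := by
  have ha0 : 0 ≤ a := zero_le_one.trans ha
  induction K generalizing G Q with
  | zero =>
    simp only [Nat.min_zero, pow_zero, Ex_const]
    exact one_le_pow₀ (by linarith)
  | succ K ih =>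
    obtain rfl | ⟨q, hq⟩ := Q.eq_empty_or_nonempty
    · simp [Ex_const]
    set N : Finset E → ℝ := fun B => ((exits L (S q) q B).card : ℝ) with hNdef
    set C : ℝ := a ^ M * (1 + x) ^ (Q.card - 1) with hC
    have hC0 : 0 ≤ C := by positivity
    have hMpos : 1 ≤ M := (Finset.card_pos.2 ⟨q, hS q⟩).trans_le (hM q)
    set T : Finset E → Finset Pt := fun B => (S q).filter (· ∈ cl L B (S q) q) with hT
    have hTc : ∀ B, (T B : Set Pt) = cl L B (S q) q := by
      intro B
      ext u
      simp only [hT, Finset.coe_filter, mem_ofPred_eq]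
      exact ⟨fun h => h.2, fun h => ⟨cl_subset (hS q) h, h⟩⟩
    have hTiff : ∀ B T0, T B = T0 ↔ cl L B (S q) q = T0 := by
      intro B T0
      rw [← hTc, Finset.coe_inj]
    have hsplit : ∀ h : Finset E → ℝ, Ex p G h =
        ∑ T0 ∈ (S q).powerset, Ex p G (fun B => if T B = T0 then h B else 0) := by
      intro h
      rw [← Ex_sum]
      refine Ex_congr fun B _ => ?_
      rw [Finset.sum_ite_eq, if_pos]
      exact Finset.mem_powerset.2 (Finset.filter_subset _ _)
    have hstep : ∀ T0 ∈ (S q).powerset, Ex p G (fun B => if T B = T0 then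
        a ^ min (⋃ q ∈ Q, cl L B univ q).ncard (K + 1) else 0) ≤
        Ex p G (fun B => if T B = T0 then C * (1 + 3 / 2 * x * N B) else 0) := by
      intro T0 hT0
      have hT0 := Finset.mem_powerset.1 hT0
      have hG : G.filter (Touches L (T0 : Set Pt)) ∪
          G.filter (fun e => ¬ Touches L (T0 : Set Pt) e) = G :=
        Finset.filter_union_filter_not_eq _ G
      rw [← hG, Ex_union p (Finset.disjoint_filter_filter_not _ _ _),
        Ex_union p (Finset.disjoint_filter_filter_not _ _ _)]
      refine Ex_mono hp fun A hA => ?_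
      have hA' : ∀ e ∈ A, Touches L (T0 : Set Pt) e := fun e he => (Finset.mem_filter.1 (hA he)).2
      have hiff : ∀ B ⊆ G.filter (fun e => ¬ Touches L (T0 : Set Pt) e),
          (T (A ∪ B) = T0 ↔ T A = T0) := by
        intro B hB
        rw [hTiff, hTiff]
        exact cl_union_eq_iff fun e he => (Finset.mem_filter.1 (hB he)).2
      by_cases hTA : T A = T0
      swap
      · refine Ex_mono hp fun B hB => ?_
        rw [if_neg (mt (hiff B hB).1 hTA), if_neg (mt (hiff B hB).1 hTA)]
      have hcl : cl L A (S q) q = T0 := (hTiff _ _).1 hTA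
      have hqT : q ∈ (T0 : Set Pt) := hcl ▸ mem_cl_self _ _ _
      set Q' := Q.erase q ∪ (A.filter (Bdry L (T0 : Set Pt))).image (out L (T0 : Set Pt)) with hQ'
      have hexit : A.filter (Bdry L (T0 : Set Pt)) ⊆ exits L (S q) q A := by
        intro e he
        obtain ⟨heA, hb⟩ := Finset.mem_filter.1 he
        obtain ⟨hj, hi, ho⟩ := hb.joins
        have hiS : inn L (T0 : Set Pt) e ∈ (S q : Set Pt) := hT0 hi
        have hoS : out L (T0 : Set Pt) e ∉ (S q : Set Pt) := by
          intro hoS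
          refine ho ?_
          rw [← hcl] at hi ⊢
          exact cl_step hi ⟨e, heA, by rwa [hcl], by rwa [hcl], by rwa [hcl]⟩
        obtain ⟨h1, h2, -⟩ := hj.bdry hiS hoS
        refine Finset.mem_filter.2 ⟨heA, h1, ?_⟩
        rw [h2, hcl]
        exact hi
      have hQcard : Q'.card ≤ Q.card - 1 + (exits L (S q) q A).card := by
        refine (Finset.card_union_le _ _).trans ?_
        rw [Finset.card_erase_of_mem hq]
        exact Nat.add_le_add_left (Finset.card_image_le.trans (Finset.card_le_card hexit)) _
      have hNx : ((exits L (S q) q A).card : ℝ) * x ≤ 1 / 2 := by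
        refine (mul_le_mul_of_nonneg_right ?_ hx).trans hDx
        refine Nat.cast_le.2 ((Finset.card_le_card ?_).trans (hD q A))
        intro e he
        obtain ⟨heA, hb, -⟩ := Finset.mem_filter.1 he
        exact Finset.mem_filter.2 ⟨heA, hb.touches⟩
      calc _ ≤ Ex p (G.filter fun e => ¬ Touches L (T0 : Set Pt) e) (fun B =>
            a ^ M * a ^ min (⋃ u ∈ Q', cl L B univ u).ncard K) := by
            refine Ex_mono hp fun B hB => ?_
            rw [if_pos ((hiff B hB).2 hTA), ← pow_add]
            refine pow_le_pow_right₀ ha ?_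
            have hsub := biUnion_cl_subset (Q := Q) hqT hA' (B := B)
              fun e he => (Finset.mem_filter.1 (hB he)).2
            rw [← hQ'] at hsub
            have h1 := (Set.ncard_le_ncard hsub
              (T0.finite_toSet.union (finite_biUnion_cl B univ Q'))).trans (Set.ncard_union_le _ _)
            rw [Set.ncard_coe_finset] at h1
            have h2 := (Finset.card_le_card hT0).trans (hM q)
            omega
        _ ≤ a ^ M * (1 + x) ^ Q'.card := by
            rw [Ex_const_mul]
            exact mul_le_mul_of_nonneg_left (ih _ _) (by positivity)
        _ ≤ a ^ M * (1 + x) ^ (Q.card - 1 + (exits L (S q) q A).card) := by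
            refine mul_le_mul_of_nonneg_left (pow_le_pow_right₀ (by linarith) hQcard)
              (by positivity)
        _ = C * (1 + x) ^ (exits L (S q) q A).card := by rw [hC, pow_add, mul_assoc]
        _ ≤ C * (1 + 3 / 2 * x * N A) :=
            mul_le_mul_of_nonneg_left (one_add_pow_le hx _ hNx) hC0
        _ = Ex p (G.filter fun e => ¬ Touches L (T0 : Set Pt) e) (fun _ =>
            C * (1 + 3 / 2 * x * N A)) := (Ex_const _ _ _).symm
        _ ≤ _ := by
            refine Ex_mono hp fun B hB => ?_
            rw [if_pos ((hiff B hB).2 hTA)]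
            refine mul_le_mul_of_nonneg_left ?_ hC0
            have : N A ≤ N (A ∪ B) :=
              Nat.cast_le.2 (Finset.card_le_card (exits_mono _ _ Finset.subset_union_left))
            have := mul_le_mul_of_nonneg_left this (show 0 ≤ 3 / 2 * x by positivity)
            linarith
    rw [hsplit]
    refine (Finset.sum_le_sum hstep).trans ?_
    rw [← hsplit, Ex_const_mul, Ex_add, Ex_const, Ex_const_mul]
    have h1 := mul_le_mul_of_nonneg_left (hN q G) (show 0 ≤ 3 / 2 * x by positivity)
    have h2 : (1 + x) ^ Q.card = (1 + x) ^ (Q.card - 1) * (1 + x) := by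
      rw [← pow_succ, Nat.sub_add_cancel (Finset.card_pos.2 ⟨q, hq⟩)]
    rw [h2, hC]
    calc _ ≤ a ^ M * (1 + x) ^ (Q.card - 1) * (1 + 3 / 4 * x) :=
          mul_le_mul_of_nonneg_left (by linarith) hC0
      _ = (1 + x) ^ (Q.card - 1) * (a ^ M * (1 + 3 / 4 * x)) := by ring
      _ ≤ _ := mul_le_mul_of_nonneg_left haM (by positivity)

end Branching

section Cylinders

open scoped Classical

variable {E : Type} {L : LatticeOn E}

/-- The open edges in `F`. -/
noncomputable def opens (F : Finset E) (ω : Config E) : Finset E := F.filter (ω · = true)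

lemma opens_mono {F F' : Finset E} (h : F ⊆ F') (ω : Config E) : opens F ω ⊆ opens F' ω :=
  Finset.filter_subset_filter _ h

lemma opens_eq_iff {F B : Finset E} (hB : B ⊆ F) (ω : Config E) :
    opens F ω = B ↔ ∀ e ∈ F, ω e = decide (e ∈ B) := by
  constructor
  · rintro rfl e he
    cases h : ω e <;> simp [opens, he, h]
  · intro h
    ext e
    simp only [opens, Finset.mem_filter]
    constructor
    · rintro ⟨he, hω⟩
      rw [h e he] at hω
      simpa using hω
    · intro he
      exact ⟨hB he, by rw [h e (hB he)]; simpa using he⟩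

/-- The probability of an event determined by finitely many edges. -/
lemma IsBernoulliProduct.measure_opens {p : E → ℝ} {P : Measure (Config E)}
    (hP : IsBernoulliProduct p P) (hp : ∀ e, p e ∈ Icc (0:ℝ) 1) (F : Finset E)
    (Q : Finset E → Prop) [DecidablePred Q] :
    P {ω | Q (opens F ω)} = ENNReal.ofReal (Ex p F fun B => if Q B then 1 else 0) := by
  have hset : {ω : Config E | Q (opens F ω)} =
      ⋃ B ∈ F.powerset.filter Q, {ω : Config E | ∀ e ∈ F, ω e = decide (e ∈ B)} := by
    ext ω
    simp only [mem_iUnion, exists_prop, Finset.mem_filter, Finset.mem_powerset]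
    constructor
    · intro h
      exact ⟨opens F ω, ⟨Finset.filter_subset _ _, h⟩,
        (opens_eq_iff (Finset.filter_subset _ _) ω).1 rfl⟩
    · rintro ⟨B, ⟨hB, hQ⟩, h⟩
      have := (opens_eq_iff hB ω).2 h
      change Q (opens F ω)
      rwa [this]
  rw [hset, measure_biUnion_finset]
  · simp only [hP.2]
    unfold Ex
    rw [ENNReal.ofReal_sum_of_nonneg fun B _ => mul_nonneg (weight_nonneg hp F B)
      (by split_ifs <;> norm_num), Finset.sum_filter]
    refine Finset.sum_congr rfl fun B _ => ?_
    split_ifs with hQ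
    · rw [mul_one, ENNReal.ofReal_prod_of_nonneg]
      · exact Finset.prod_congr rfl fun e _ => by simp
      · intro e _
        have := hp e
        split_ifs
        · exact this.1
        · linarith [this.2]
    · simp
  · intro B hB B' hB' hne
    refine Set.disjoint_left.2 fun ω h h' => hne ?_
    have hB := Finset.mem_powerset.1 (Finset.mem_filter.1 hB).1
    have hB' := Finset.mem_powerset.1 (Finset.mem_filter.1 hB').1
    rw [← (opens_eq_iff hB ω).2 h, ← (opens_eq_iff hB' ω).2 h']
  · intro B _
    have : {ω : Config E | ∀ e ∈ F, ω e = decide (e ∈ B)} =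
        ⋂ e ∈ F, (fun ω : Config E => ω e) ⁻¹' {decide (e ∈ B)} := by
      ext ω
      simp
    rw [this]
    exact Finset.measurableSet_biInter F fun e _ =>
      measurable_pi_apply e (measurableSet_singleton _)

lemma measure_iUnion_finset_le [Countable E] {P : Measure (Config E)}
    {A : Finset E → Set (Config E)} (hA : Monotone A) {c : ENNReal} (h : ∀ F, P (A F) ≤ c) :
    P (⋃ F, A F) ≤ c := by
  rw [(directed_of_isDirected_le hA).measure_iUnion]
  exact iSup_le h

lemma cluster_eq (ω : Config E) (v : Pt) : cluster L ω v = cl L {e | ω e = true} univ v := by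
  have : openAdj L ω = AdjIn L {e | ω e = true} univ := by
    ext u w
    simp [openAdj, AdjIn, Joins]
  simp only [cluster, cl, openConn, this]

lemma cl_opens_subset (F : Finset E) (ω : Config E) (v : Pt) :
    cl L (opens F ω) univ v ⊆ cluster L ω v := by
  rw [cluster_eq]
  refine cl_mono (fun e he => ?_) subset_rfl v
  exact (Finset.mem_filter.1 (Finset.mem_coe.1 he)).2

lemma exists_mem_cl_opens {ω : Config E} {v u : Pt} (h : u ∈ cluster L ω v) :
    ∃ F : Finset E, u ∈ cl L (opens F ω) univ v := by
  rw [cluster_eq] at h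
  induction h with
  | refl => exact ⟨∅, mem_cl_self _ _ _⟩
  | @tail b c _ hbc ih =>
    obtain ⟨F, hF⟩ := ih
    obtain ⟨e, he, hj, -, -⟩ := hbc
    refine ⟨insert e F, cl_step (cl_mono (Finset.coe_subset.2
      (opens_mono (Finset.subset_insert e F) ω)) subset_rfl v hF)
      ⟨e, Finset.mem_coe.2 (Finset.mem_filter.2 ⟨Finset.mem_insert_self e F, he⟩), hj,
        mem_univ _, mem_univ _⟩⟩

lemma exists_le_ncard_cl_opens {ω : Config E} {v : Pt} {k : ℕ}
    (h : (k : ℕ∞) ≤ (cluster L ω v).encard) :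
    ∃ F : Finset E, k ≤ (cl L (opens F ω) univ v).ncard := by
  obtain ⟨T, hT, hTk⟩ := Set.exists_subset_encard_eq h
  have hfin : T.Finite := Set.finite_of_encard_eq_coe hTk
  choose! F hF using fun u (hu : u ∈ T) => exists_mem_cl_opens (hT hu)
  refine ⟨hfin.toFinset.biUnion F, ?_⟩
  have hsub : T ⊆ cl L (opens (hfin.toFinset.biUnion F) ω) univ v := fun u hu =>
    cl_mono (Finset.coe_subset.2 (opens_mono
      (Finset.subset_biUnion_of_mem F (hfin.mem_toFinset.2 hu)) ω)) subset_rfl v (hF u hu)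
  have := Set.ncard_le_ncard hsub (finite_cl _ _ _)
  rwa [Set.ncard, hTk, ENat.toNat_natCast] at this

end Cylinders

section Volume

open scoped Classical

variable {E : Type} {L : LatticeOn E}

/-- Edges have bounded length, and the lattice is uniformly locally finite. -/
def LocallyFinite (L : LatticeOn E) : Prop :=
  (∀ e, dist (L.ends e).1 (L.ends e).2 ≤ 2) ∧
    ∀ R : ℝ, ∃ M : ℕ, ∀ v, ∃ F : Finset E, F.card ≤ M ∧
      ∀ e, Touches L (Metric.closedBall v R) e → e ∈ F

lemma Ex_mem {p : E → ℝ} {F : Finset E} {e : E} (he : e ∈ F) :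
    Ex p F (fun B => if e ∈ B then (1:ℝ) else 0) = p e := by
  have h := mul_Ex_erase p he fun _ => (1:ℝ)
  rw [Ex_const, mul_one] at h
  have h2 : Ex p F (fun B => if e ∈ B then (1:ℝ) else 0) =
      Ex p F fun B => 1 - if e ∈ B then (0:ℝ) else 1 :=
    Ex_congr fun B _ => by split_ifs <;> norm_num
  rw [h2, Ex_sub, Ex_const, ← h]
  ring

lemma Ex_exits_le {p : E → ℝ} (hp : ∀ e, p e ∈ Icc (0:ℝ) 1) (S : Set Pt) (q : Pt)
    {F : Finset E} (hF : ∀ e, Touches L S e → e ∈ F) (G : Finset E) :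
    Ex p G (fun B => ((exits L S q B).card : ℝ)) ≤ ∑ e ∈ F.filter (Bdry L S),
      p e * Ex p F fun B => if inn L S e ∈ cl L B S q then 1 else 0 := by
  have hm : ∀ e, Monotone fun B : Finset E =>
      if inn L S e ∈ cl L (B : Set E) S q then (1:ℝ) else 0 := fun e =>
    monotone_ite fun A B hAB h => cl_mono (Finset.coe_subset.2 hAB) subset_rfl q h
  have hnn : ∀ e (F : Finset E),
      0 ≤ Ex p F fun B => if inn L S e ∈ cl L B S q then (1:ℝ) else 0 := fun e F =>
    Ex_nonneg hp fun B _ => by split_ifs <;> norm_num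
  calc Ex p G (fun B => ((exits L S q B).card : ℝ))
      = Ex p G (fun B => ∑ e ∈ G.filter (Bdry L S),
          (if inn L S e ∈ cl L B S q then 1 else 0) * if e ∈ B then 1 else 0) := by
        refine Ex_congr fun B hB => ?_
        rw [exits, Finset.card_filter, Nat.cast_sum, Finset.sum_filter, ← Finset.sum_subset hB]
        · refine Finset.sum_congr rfl fun e he => ?_
          by_cases h1 : Bdry L S e <;> simp [he, h1]
        · intro e _ he
          simp [he]
    _ = ∑ e ∈ G.filter (Bdry L S),
          p e * Ex p G fun B => if inn L S e ∈ cl L B S q then 1 else 0 := by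
        rw [Ex_sum]
        refine Finset.sum_congr rfl fun e he => ?_
        obtain ⟨heG, hb⟩ := Finset.mem_filter.1 he
        rw [Ex_mul_filter p G (Inside L S) (fun B _ => by rw [cl_filter_inside]), Ex_mem heG,
          mul_comm]
        intro B _
        simp [hb.not_inside]
    _ ≤ ∑ e ∈ G.filter (Bdry L S),
          p e * Ex p F fun B => if inn L S e ∈ cl L B S q then 1 else 0 := by
        refine Finset.sum_le_sum fun e _ => mul_le_mul_of_nonneg_left ?_ (hp e).1
        rw [Ex_inter p (Finset.inter_subset_left (s₁ := G) (s₂ := F))]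
        · exact Ex_le_Ex_of_subset hp Finset.inter_subset_right (hm e)
        · intro B hB
          have : (B ∩ (G ∩ F)).filter (Inside L S) = B.filter (Inside L S) := by
            ext e
            simp only [Finset.mem_filter, Finset.mem_inter]
            refine ⟨fun h => ⟨h.1.1, h.2⟩, fun h => ⟨⟨h.1, hB h.1, hF e (Or.inl h.2.1)⟩, h.2⟩⟩
          rw [← cl_filter_inside (B ∩ (G ∩ F)), this, cl_filter_inside]
    _ ≤ _ := by
        refine Finset.sum_le_sum_of_subset_of_nonneg (fun e he => ?_) fun e _ _ =>
          mul_nonneg (hp e).1 (hnn e F)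
        obtain ⟨-, hb⟩ := Finset.mem_filter.1 he
        exact Finset.mem_filter.2 ⟨hF e hb.touches, hb⟩

/-- At intensities reduced by `ν` from intensities at which clusters are unlikely to be large, each
point lies in a bounded set from which there are few exits. -/
lemma exists_few_exits (hL : LocallyFinite L) {p pu : E → ℝ} {ν : ℝ} (hν : 0 < ν)
    (hp : ∀ e, p e ∈ Icc (0:ℝ) 1) (hpu : ∀ e, pu e = if p e = 1 then 1 else max (p e - ν) 0)
    {P : Measure (Config E)} (hP : IsBernoulliProduct p P)
    (hrad : ∀ ε > 0, ∃ n : ℝ, ∀ v, P {ω | ∃ u ∈ cluster L ω v, n ≤ dist u v} ≤ ENNReal.ofReal ε) :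
    ∃ M D : ℕ, 0 < M ∧ 0 < D ∧ ∃ S : Pt → Finset Pt, (∀ q, q ∈ S q) ∧ (∀ q, (S q).card ≤ M) ∧
      (∀ q (G : Finset E), (G.filter (Touches L (S q : Set Pt))).card ≤ D) ∧
      ∀ q (G : Finset E), Ex pu G (fun B => ((exits L (S q) q B).card : ℝ)) ≤ 1 / 2 := by
  have hpuI : ∀ e, pu e ∈ Icc (0:ℝ) 1 := by
    intro e
    rw [hpu]
    split_ifs
    · simp
    · exact ⟨le_max_right _ _, max_le (by linarith [(hp e).2]) zero_le_one⟩
  have hle : ∀ e, pu e ≤ p e := by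
    intro e
    rw [hpu]
    split_ifs with h
    · exact h.ge
    · exact max_le (by linarith) (hp e).1
  set c : ℝ := min ν 1 with hc
  have hc0 : 0 < c := lt_min hν one_pos
  have hc1 : c ≤ 1 := min_le_right _ _
  have hgap : ∀ e, p e ≠ 1 → c * p e ≤ p e - pu e := by
    intro e he
    rw [hpu, if_neg he, le_sub_comm]
    have h0 := (hp e).1
    have h1 := (hp e).2
    have h2 : c ≤ ν := min_le_left _ _
    refine max_le (by nlinarith) (by nlinarith)
  obtain ⟨n, hn⟩ := hrad (c / 8) (by positivity)
  obtain ⟨hlen, hfin⟩ := hL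
  obtain ⟨M, hM⟩ := hfin n
  obtain ⟨D, hD⟩ := hfin (max n 0 + 2)
  have hex : ∀ q, ∃ S : Finset Pt, q ∈ S ∧ S.card ≤ 2 * M + 1 ∧
      (∀ G : Finset E, (G.filter (Touches L (S : Set Pt))).card ≤ D + 1) ∧
      ∀ G : Finset E, Ex pu G (fun B => ((exits L S q B).card : ℝ)) ≤ 1 / 2 := by
    intro q
    obtain ⟨F₁, hF₁M, hF₁⟩ := hM q
    obtain ⟨F, hFD, hF⟩ := hD q
    set Λ : Finset Pt := insert q ((F₁.image (fun e => (L.ends e).1) ∪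
      F₁.image (fun e => (L.ends e).2)).filter fun z => dist z q ≤ n) with hΛ
    have hΛcard : Λ.card ≤ 2 * M + 1 := by
      refine (Finset.card_insert_le _ _).trans (Nat.add_le_add_right ?_ 1)
      refine (Finset.card_filter_le _ _).trans ((Finset.card_union_le _ _).trans ?_)
      have h1 := Finset.card_image_le (s := F₁) (f := fun e => (L.ends e).1)
      have h2 := Finset.card_image_le (s := F₁) (f := fun e => (L.ends e).2)
      omega
    have hΛF : ∀ e, Touches L (Λ : Set Pt) e → e ∈ F := by
      intro e he
      have hball : (Λ : Set Pt) ⊆ Metric.closedBall q (max n 0 + 2) := by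
        intro z hz
        rw [Metric.mem_closedBall]
        rcases Finset.mem_insert.1 (Finset.mem_coe.1 hz) with rfl | hz
        · rw [dist_self]; positivity
        · have := (Finset.mem_filter.1 hz).2
          have := le_max_left n 0
          linarith
      exact hF e (he.imp (fun h => hball h) fun h => hball h)
    have hreach : ∀ ω, Reach L Λ (opens F ω) q → ∃ u ∈ cluster L ω q, n ≤ dist u q := by
      rintro ω ⟨u, huΛ, hu⟩
      refine ⟨u, cl_opens_subset F ω q hu, ?_⟩
      by_contra hlt
      push Not at hlt
      refine huΛ ?_
      obtain rfl | ⟨w, -, e, -, hj, -, -⟩ := Relation.ReflTransGen.cases_tail hu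
      · exact Finset.mem_insert_self _ _
      · have he := hF₁ e (hj.symm.touches (Metric.mem_closedBall.2 hlt.le))
        refine Finset.mem_insert_of_mem (Finset.mem_filter.2 ⟨Finset.mem_union.2 ?_, hlt.le⟩)
        rcases hj with hj | hj
        · exact Or.inr (Finset.mem_image.2 ⟨e, he, by rw [hj]⟩)
        · exact Or.inl (Finset.mem_image.2 ⟨e, he, by rw [hj]⟩)
    have hθ : Ex p F (fun B => if Reach L Λ B q then 1 else 0) ≤ c / 8 := by
      have h1 := hP.measure_opens hp F fun B => Reach L Λ B q
      have h2 := (measure_mono (μ := P) (show {ω | Reach L Λ (opens F ω) q} ⊆ _ from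
        hreach)).trans (hn q)
      rw [h1] at h2
      exact (ENNReal.ofReal_le_ofReal_iff (by positivity)).1 h2
    have hexS : ∃ S ⊆ Λ, q ∈ S ∧ ∑ e ∈ F.filter (Bdry L (S : Set Pt)),
        pu e * Ex pu F (fun B => if inn L S e ∈ cl L B S q then 1 else 0) < 1 / 2 := by
      by_contra hcon
      push Not at hcon
      have := le_reach_of_exits (Finset.mem_insert_self q _) F hc0.le hp hpuI hle
        (fun e he => by rw [hpu, if_pos he]) hgap hcon
      nlinarith
    obtain ⟨S, hSΛ, hqS, hsum⟩ := hexS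
    have hSF : ∀ e, Touches L (S : Set Pt) e → e ∈ F := fun e he =>
      hΛF e (he.imp (fun h => hSΛ h) fun h => hSΛ h)
    refine ⟨S, hqS, (Finset.card_le_card hSΛ).trans hΛcard, fun G => ?_, fun G =>
      (Ex_exits_le hpuI S q hSF G).trans hsum.le⟩
    refine (Finset.card_le_card (t := F) fun e he => hSF e (Finset.mem_filter.1 he).2).trans ?_
    omega
  choose S h1 h2 h3 h4 using hex
  exact ⟨2 * M + 1, D + 1, by omega, by omega, S, h1, h2, h3, h4⟩

/-- Exponential decay of the volume at reduced intensities. -/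
lemma exists_exp_decay [Countable E] (hL : LocallyFinite L) {p : E → ℝ} {ν : ℝ} (hν : 0 < ν)
    (hp : ∀ e, p e ∈ Icc (0:ℝ) 1) {P : Measure (Config E)} (hP : IsBernoulliProduct p P)
    (hrad : ∀ ε > 0, ∃ n : ℝ, ∀ v, P {ω | ∃ u ∈ cluster L ω v, n ≤ dist u v} ≤ ENNReal.ofReal ε) :
    ∃ c : ℝ, 0 < c ∧ ∃ d : ℝ, 0 < d ∧ ∀ Pu : Measure (Config E),
      IsBernoulliProduct (fun e => if p e = 1 then 1 else max (p e - ν) 0) Pu →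
      ∀ v, ∀ k : ℕ, Pu {ω | (k : ℕ∞) ≤ (cluster L ω v).encard} ≤
        ENNReal.ofReal (c * Real.exp (-d * k)) := by
  set pu : E → ℝ := fun e => if p e = 1 then 1 else max (p e - ν) 0 with hpu
  have hpuI : ∀ e, pu e ∈ Icc (0:ℝ) 1 := by
    intro e
    simp only [hpu]
    split_ifs
    · simp
    · exact ⟨le_max_right _ _, max_le (by linarith [(hp e).2]) zero_le_one⟩
  obtain ⟨M, D, hM0, hD0, S, hS, hM, hD, hN⟩ :=
    exists_few_exits hL hν hp (fun e => rfl : ∀ e, pu e = _) hP hrad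
  have hM0' : (0:ℝ) < M := Nat.cast_pos.2 hM0
  have hD0' : (1:ℝ) ≤ D := Nat.one_le_cast.2 hD0
  set x : ℝ := 1 / (2 * D) with hx
  have hx0 : 0 < x := by positivity
  have hDx : D * x = 1 / 2 := by rw [hx]; field_simp
  have hx1 : x ≤ 1 / 2 := by nlinarith
  set d : ℝ := x / (8 * M) with hd
  have hd0 : 0 < d := by positivity
  have haM : Real.exp d ^ M * (1 + 3 / 4 * x) ≤ 1 + x := by
    rw [← Real.exp_nat_mul]
    have h1 : (M:ℝ) * d = x / 8 := by rw [hd]; field_simp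
    rw [h1]
    have h2 : Real.exp (x / 8) * (1 - x / 8) ≤ 1 := by
      have := Real.add_one_le_exp (-(x / 8))
      calc Real.exp (x / 8) * (1 - x / 8) ≤ Real.exp (x / 8) * Real.exp (-(x / 8)) :=
            mul_le_mul_of_nonneg_left (by linarith) (Real.exp_pos _).le
        _ = 1 := by rw [← Real.exp_add]; simp
    have h3 := Real.exp_pos (x / 8)
    calc Real.exp (x / 8) * (1 + 3 / 4 * x) ≤ Real.exp (x / 8) * ((1 - x / 8) * (1 + x)) :=
          mul_le_mul_of_nonneg_left (by nlinarith) h3.le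
      _ = Real.exp (x / 8) * (1 - x / 8) * (1 + x) := by ring
      _ ≤ 1 * (1 + x) := mul_le_mul_of_nonneg_right h2 (by linarith)
      _ = 1 + x := one_mul _
  refine ⟨1 + x, by positivity, d, hd0, fun Pu hPu v k => ?_⟩
  have hsub : {ω : Config E | (k : ℕ∞) ≤ (cluster L ω v).encard} ⊆
      ⋃ F : Finset E, {ω | k ≤ (cl L (opens F ω) univ v).ncard} := fun ω hω => by
    obtain ⟨F, hF⟩ := exists_le_ncard_cl_opens hω
    exact mem_iUnion.2 ⟨F, hF⟩
  refine (measure_mono hsub).trans (measure_iUnion_finset_le ?_ fun F => ?_)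
  · intro F G hFG ω hω
    exact le_trans (show k ≤ _ from hω) (Set.ncard_le_ncard
      (cl_mono (Finset.coe_subset.2 (opens_mono hFG ω)) subset_rfl v) (finite_cl _ _ _))
  · rw [hPu.measure_opens hpuI F fun B => k ≤ (cl L B univ v).ncard]
    refine ENNReal.ofReal_le_ofReal ?_
    have h1 := exp_moment_le hpuI (Real.one_le_exp hd0.le) hx0.le hDx.le haM S hS hM hD hN k F {v}
    simp only [Finset.mem_singleton, iUnion_iUnion_eq_left, Finset.card_singleton, pow_one] at h1
    have h2 : Real.exp d ^ k * Ex pu F (fun B => if k ≤ (cl L B univ v).ncard then 1 else 0) ≤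
        1 + x := by
      rw [← Ex_const_mul]
      refine (Ex_mono hpuI fun B _ => ?_).trans h1
      split_ifs with hk
      · rw [mul_one, min_eq_right hk]
      · rw [mul_zero]; positivity
    rw [← Real.exp_nat_mul] at h2
    have h3 : -d * (k:ℝ) = -(k * d) := by ring
    rw [h3, Real.exp_neg, ← div_eq_mul_inv, le_div_iff₀ (Real.exp_pos _), mul_comm]
    exact h2

end Volume

section Barriers

variable {E : Type} {L Ld : LatticeOn E}

/-- The first coordinate in the frame rotated by `θ`. -/
noncomputable def xd (θ : ℝ) (z : Pt) : ℝ := Real.cos θ * z.1 + Real.sin θ * z.2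

/-- The second coordinate in the frame rotated by `θ`. -/
noncomputable def yd (θ : ℝ) (z : Pt) : ℝ := -Real.sin θ * z.1 + Real.cos θ * z.2

/-- The four axis directions. -/
noncomputable def dirs : Finset ℝ := {0, Real.pi / 2, Real.pi, -(Real.pi / 2)}

/-- The rectangle at distance `r` from `v` in direction `θ`, with sides `2 * r` and `6 * r`. -/
def rect (θ : ℝ) (v : Pt) (r : ℝ) : Set Pt :=
  {z | r ≤ xd θ (z - v) ∧ xd θ (z - v) ≤ 3 * r ∧ -(3 * r) ≤ yd θ (z - v) ∧ yd θ (z - v) ≤ 3 * r}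

/-- The rectangle `rect θ v r` is crossed in its long direction. -/
def Barrier (Ld : LatticeOn E) (v : Pt) (r : ℝ) (ω : Config E) (θ : ℝ) : Prop :=
  CrossingIn Ld ω (rect θ v r) {z | yd θ (z - v) = -(3 * r)} {z | yd θ (z - v) = 3 * r}

lemma dirs_cases {θ : ℝ} (h : θ ∈ dirs) : (Real.cos θ = 1 ∧ Real.sin θ = 0) ∨
    (Real.cos θ = 0 ∧ Real.sin θ = 1) ∨ (Real.cos θ = -1 ∧ Real.sin θ = 0) ∨
    (Real.cos θ = 0 ∧ Real.sin θ = -1) := by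
  simp only [dirs, Finset.mem_insert, Finset.mem_singleton] at h
  rcases h with rfl | rfl | rfl | rfl <;> simp

lemma continuous_xd (θ : ℝ) (v : Pt) : Continuous fun z : Pt => xd θ (z - v) := by
  unfold xd
  fun_prop

lemma continuous_yd (θ : ℝ) (v : Pt) : Continuous fun z : Pt => yd θ (z - v) := by
  unfold yd
  fun_prop

lemma eq_of_xd_yd {θ : ℝ} {v a b : Pt} (hx : xd θ (a - v) = xd θ (b - v))
    (hy : yd θ (a - v) = yd θ (b - v)) : a = b := by
  simp only [xd, yd, Prod.fst_sub, Prod.snd_sub] at hx hy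
  have h := Real.sin_sq_add_cos_sq θ
  ext
  · linear_combination Real.cos θ * hx - Real.sin θ * hy + (b.1 - a.1) * h
  · linear_combination Real.sin θ * hx + Real.cos θ * hy + (b.2 - a.2) * h

lemma dist_le_iff {z v : Pt} {r : ℝ} : dist z v ≤ r ↔
    (-r ≤ z.1 - v.1 ∧ z.1 - v.1 ≤ r) ∧ (-r ≤ z.2 - v.2 ∧ z.2 - v.2 ≤ r) := by
  rw [Prod.dist_eq, max_le_iff, Real.dist_eq, Real.dist_eq, abs_le, abs_le]

lemma xd_yd_mem_of_dist_le {θ : ℝ} (hθ : θ ∈ dirs) {z v : Pt} {r : ℝ} (h : dist z v ≤ r) :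
    xd θ (z - v) ≤ r ∧ -r ≤ yd θ (z - v) ∧ yd θ (z - v) ≤ r := by
  obtain ⟨⟨h1, h2⟩, h3, h4⟩ := dist_le_iff.1 h
  rcases dirs_cases hθ with h | h | h | h <;>
    simp only [xd, yd, h.1, h.2, Prod.fst_sub, Prod.snd_sub] <;>
    refine ⟨?_, ?_, ?_⟩ <;> linarith

lemma dist_le_of_mem_rect {θ : ℝ} (hθ : θ ∈ dirs) {z v : Pt} {r : ℝ} (h : z ∈ rect θ v r) :
    r ≤ dist z v ∧ dist z v ≤ 3 * r := by
  obtain ⟨h1, h2, h3, h4⟩ := h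
  refine ⟨h1.trans (xd_yd_mem_of_dist_le hθ le_rfl).1, dist_le_iff.2 ?_⟩
  have h5 : 0 ≤ r := by linarith
  rcases dirs_cases hθ with h | h | h | h <;>
    simp only [xd, yd, h.1, h.2, Prod.fst_sub, Prod.snd_sub] at h1 h2 h3 h4 <;>
    refine ⟨⟨?_, ?_⟩, ?_, ?_⟩ <;> linarith

lemma exists_dirs_xd_eq {z v : Pt} {r : ℝ} (h : dist z v = r) : ∃ θ ∈ dirs, xd θ (z - v) = r := by
  rw [Prod.dist_eq, Real.dist_eq, Real.dist_eq] at h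
  rcases max_choice |z.1 - v.1| |z.2 - v.2| with hm | hm <;> rw [hm] at h
  · rcases abs_choice (z.1 - v.1) with ha | ha
    · exact ⟨0, by simp [dirs], by simp [xd, ← h, ha]⟩
    · exact ⟨Real.pi, by simp [dirs], by simp [xd, ← h, ha]⟩
  · rcases abs_choice (z.2 - v.2) with ha | ha
    · exact ⟨Real.pi / 2, by simp [dirs], by simp [xd, ← h, ha]⟩
    · exact ⟨-(Real.pi / 2), by simp [dirs], by simp [xd, ← h, ha]⟩

/-- A continuous function passing from at most `a` to at least `a` takes the value `a` at a first
time at which it is at least `a`. -/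
lemma exists_first_hit {φ : ℝ → ℝ} (hφ : Continuous φ) {s t a : ℝ} (hst : s ≤ t) (h0 : φ s ≤ a)
    (h1 : a ≤ φ t) : ∃ τ ∈ Icc s t, φ τ = a ∧ ∀ u ∈ Icc s τ, φ u ≤ a := by
  have hK : IsCompact (Icc s t ∩ {u | a ≤ φ u}) :=
    isCompact_Icc.inter_right (isClosed_le continuous_const hφ)
  obtain ⟨τ, ⟨hτ, hτa⟩, hleast⟩ := hK.exists_isLeast ⟨t, right_mem_Icc.2 hst, h1⟩
  have heq : φ τ = a := by
    obtain ⟨u, hu, hua⟩ := intermediate_value_Icc hτ.1 hφ.continuousOn ⟨h0, hτa⟩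
    have := hleast ⟨⟨hu.1, hu.2.trans hτ.2⟩, hua.ge⟩
    rw [le_antisymm hu.2 this] at hua
    exact hua
  refine ⟨τ, hτ, heq, fun u hu => ?_⟩
  by_contra hlt
  push Not at hlt
  have := hleast ⟨⟨hu.1, hu.2.trans hτ.2⟩, hlt.le⟩
  rw [le_antisymm hu.2 this, heq] at hlt
  exact lt_irrefl _ hlt

/-- A continuous function passing from at most `a` to at least `a` takes the value `a` at a last
time at which it is at most `a`. -/
lemma exists_last_hit {φ : ℝ → ℝ} (hφ : Continuous φ) {s t a : ℝ} (hst : s ≤ t) (h0 : φ s ≤ a)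
    (h1 : a ≤ φ t) : ∃ τ ∈ Icc s t, φ τ = a ∧ ∀ u ∈ Icc τ t, a ≤ φ u := by
  obtain ⟨τ, hτ, h2, h3⟩ := exists_first_hit (φ := fun u => -φ (-u)) (by fun_prop)
    (neg_le_neg hst) (a := -a) (by simpa using h1) (by simpa using h0)
  refine ⟨-τ, ⟨by linarith [hτ.2], by linarith [hτ.1]⟩, by linarith, fun u hu => ?_⟩
  have := h3 (-u) ⟨by linarith [hu.2], by linarith [hu.1]⟩
  simpa using this

lemma joinedIn_of_mem_cluster {ω : Config E} {v u : Pt} (h : u ∈ cluster L ω v) :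
    JoinedIn (insert v (openEdgeSet L ω)) v u := by
  induction h with
  | refl => exact JoinedIn.refl (mem_insert _ _)
  | @tail b c _ hbc ih =>
    refine ih.trans ?_
    obtain ⟨e, he, hj⟩ := hbc
    have hsub : segment ℝ b c ⊆ insert v (openEdgeSet L ω) := by
      refine Subset.trans ?_ (subset_insert _ _)
      intro z hz
      refine mem_iUnion₂.2 ⟨e, he, ?_⟩
      rcases hj with hj | hj <;> rw [hj]
      · exact hz
      · rwa [segment_symm]
    exact JoinedIn.of_segment_subset hsub

/-- Dual barriers in all four directions prevent long primal connections. -/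
lemma not_barrier_of_mem_cluster
    (hdual : ∀ e f, (segment ℝ (L.ends e).1 (L.ends e).2 ∩
      segment ℝ (Ld.ends f).1 (Ld.ends f).2).Nonempty → e = f)
    {ω : Config E} {v u : Pt} {r : ℝ} (hr : 0 < r) (hu : u ∈ cluster L ω v)
    (hd : 3 * r ≤ dist u v) : ¬ ∀ θ ∈ dirs, Barrier Ld v r (fun e => !ω e) θ := by
  intro hall
  have hJ := joinedIn_of_mem_cluster hu
  set γ : ℝ → Pt := fun t => hJ.somePath.extend t with hγ
  have hγc : Continuous γ := hJ.somePath.extend.continuous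
  have hγmem : ∀ t, γ t ∈ insert v (openEdgeSet L ω) := fun t => hJ.somePath_mem _
  have hγ0 : γ 0 = v := hJ.somePath.extend_zero
  have hγ1 : γ 1 = u := hJ.somePath.extend_one
  obtain ⟨t₁, ht₁, hφ1, hφ⟩ := exists_first_hit (φ := fun t => dist (γ t) v) (by fun_prop)
    zero_le_one (a := 3 * r) (by simp only [hγ0, dist_self]; positivity) (by simpa only [hγ1])
  obtain ⟨θ, hθ, hxθ⟩ := exists_dirs_xd_eq hφ1
  obtain ⟨t₀, ht₀, hx0, hx⟩ := exists_last_hit (φ := fun t => xd θ (γ t - v))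
    ((continuous_xd θ v).comp hγc) ht₁.1 (a := r) (by simp [hγ0, xd, hr.le])
    (by rw [hxθ]; linarith)
  obtain ⟨β, hβc, hβ0, hβ1, hβ⟩ := hall θ hθ
  have hβ0 : yd θ (β 0 - v) = -(3 * r) := hβ0
  have hβ1 : yd θ (β 1 - v) = 3 * r := hβ1
  set pr : ℝ → ℝ := fun s => (projIcc (0:ℝ) 1 zero_le_one s : ℝ) with hpr
  have hprc : Continuous pr := continuous_subtype_val.comp continuous_projIcc
  have hprm : ∀ s, pr s ∈ Icc (0:ℝ) 1 := fun s => (projIcc (0:ℝ) 1 zero_le_one s).2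
  have hpre : ∀ s ∈ Icc (0:ℝ) 1, pr s = s := fun s hs => by
    rw [hpr]
    exact congrArg Subtype.val (projIcc_of_mem zero_le_one hs)
  have h01 : (0:ℝ) ∈ Icc (0:ℝ) 1 := by simp
  have h11 : (1:ℝ) ∈ Icc (0:ℝ) 1 := by simp
  set σ : ℝ → ℝ := fun s => t₀ + pr s * (t₁ - t₀) with hσ
  have hσm : ∀ s, σ s ∈ Icc t₀ t₁ := by
    intro s
    have := hprm s
    have h2 := ht₀.2
    constructor
    · simp only [hσ]; nlinarith [this.1]
    · simp only [hσ]; nlinarith [this.2]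
  obtain ⟨s, t, hst⟩ := exists_eq_of_crossing (α := fun s => γ (σ s)) (β := fun t => β (pr t))
    (hγc.comp (by fun_prop)) (hβc.comp_continuous hprc hprm)
    (fun z => xd θ (z - v)) (fun z => yd θ (z - v)) (continuous_xd θ v) (continuous_yd θ v)
    (fun a b => eq_of_xd_yd)
    (fun t _ => by
      have h2 : σ 0 = t₀ := by simp [hσ, hpre 0 h01]
      rw [h2, hx0]
      exact (hβ _ (hprm t)).1.1)
    (fun t _ => by
      have h2 : σ 1 = t₁ := by simp [hσ, hpre 1 h11]
      rw [h2, hxθ]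
      exact (hβ _ (hprm t)).1.2.1)
    (fun s _ => by
      rw [hpre 0 h01, hβ0]
      exact (xd_yd_mem_of_dist_le hθ (hφ _ ⟨ht₀.1.trans (hσm s).1, (hσm s).2⟩)).2.1)
    (fun s _ => by
      rw [hpre 1 h11, hβ1]
      exact (xd_yd_mem_of_dist_le hθ (hφ _ ⟨ht₀.1.trans (hσm s).1, (hσm s).2⟩)).2.2)
  obtain ⟨hrect, hopen⟩ := hβ _ (hprm t)
  obtain ⟨f, hf, hfz⟩ := mem_iUnion₂.1 hopen
  have hst : γ (σ s) = β (pr t) := hst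
  rcases hγmem (σ s) with hv | hv
  · have h1 := hrect.1
    rw [← hst, hv] at h1
    simp [xd] at h1
    linarith
  · obtain ⟨e, he, hez⟩ := mem_iUnion₂.1 hv
    have hef := hdual e f ⟨_, hez, hst ▸ hfz⟩
    subst hef
    have h1 : ω e = true := he
    have h2 : (!ω e) = true := hf
    simp [h1] at h2

end Barriers

section Annuli

open scoped Classical

variable {E : Type} {L Ld : LatticeOn E}

lemma CrossingIn.mono {ω ω' : Config E} {S A B : Set Pt} (h : CrossingIn L ω S A B)
    (hω : ∀ e, (segment ℝ (L.ends e).1 (L.ends e).2 ∩ S).Nonempty → ω e = true → ω' e = true) :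
    CrossingIn L ω' S A B := by
  obtain ⟨γ, hc, h0, h1, hγ⟩ := h
  refine ⟨γ, hc, h0, h1, fun t ht => ⟨(hγ t ht).1, ?_⟩⟩
  obtain ⟨e, he, hz⟩ := mem_iUnion₂.1 (hγ t ht).2
  exact mem_iUnion₂.2 ⟨e, hω e ⟨_, hz, (hγ t ht).1⟩ he, hz⟩

lemma barrier_of_hasBoxCrossings {ω : Config E} {θ r : ℝ} {v : Pt}
    (h : HasBoxCrossings L ω (2 * r) (6 * r) fun z => rot θ z + (rot θ (r, -(3 * r)) + v)) :
    Barrier L v r ω θ := by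
  have hc := Real.sin_sq_add_cos_sq θ
  have hx : ∀ z : Pt, xd θ (rot θ z + (rot θ (r, -(3 * r)) + v) - v) = z.1 + r := by
    intro z
    simp only [xd, rot, Prod.fst_sub, Prod.snd_sub, Prod.fst_add, Prod.snd_add]
    linear_combination (z.1 + r) * hc
  have hy : ∀ z : Pt, yd θ (rot θ z + (rot θ (r, -(3 * r)) + v) - v) = z.2 - 3 * r := by
    intro z
    simp only [yd, rot, Prod.fst_sub, Prod.snd_sub, Prod.fst_add, Prod.snd_add]
    linear_combination (z.2 - 3 * r) * hc
  obtain ⟨γ, hγc, ⟨a, ha, ha'⟩, ⟨b, hb, hb'⟩, hγ⟩ := h.2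
  refine ⟨γ, hγc, ?_, ?_, fun t ht => ⟨?_, (hγ t ht).2⟩⟩
  · have h1 := hy a
    rw [show a.2 = 0 from ha.1] at h1
    change yd θ (γ 0 - v) = _
    rw [← ha']
    linarith
  · have h1 := hy b
    rw [show b.2 = 6 * r from hb.1] at h1
    change yd θ (γ 1 - v) = _
    rw [← hb']
    linarith
  · obtain ⟨⟨z, ⟨h1, h2, h3, h4⟩, hz⟩, -⟩ := hγ t ht
    have hxz := hx z
    have hyz := hy z
    have hz' : rot θ z + (rot θ (r, -(3 * r)) + v) = γ t := hz
    rw [hz'] at hxz hyz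
    refine ⟨?_, ?_, ?_, ?_⟩ <;> linarith

/-- The configuration with set of open edges `B`. -/
noncomputable def cfg (B : Finset E) : Config E := fun e => decide (e ∈ B)

/-- The edges meeting the annulus at `v` with radii `r` and `3 * r`. -/
def MeetsAnnulus (L : LatticeOn E) (v : Pt) (r : ℝ) (e : E) : Prop :=
  ∃ z ∈ segment ℝ (L.ends e).1 (L.ends e).2, r ≤ dist z v ∧ dist z v ≤ 3 * r

/-- All four barriers about `v` are present. -/
def Circuit (Ld : LatticeOn E) (v : Pt) (r : ℝ) (B : Finset E) : Prop :=
  ∀ θ ∈ dirs, Barrier Ld v r (cfg B) θ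

lemma Barrier.mono {ω ω' : Config E} {v : Pt} {r θ : ℝ} (hθ : θ ∈ dirs) (h : Barrier L v r ω θ)
    (hω : ∀ e, MeetsAnnulus L v r e → ω e = true → ω' e = true) : Barrier L v r ω' θ :=
  CrossingIn.mono h fun e ⟨z, hz, hzr⟩ => hω e ⟨z, hz, dist_le_of_mem_rect hθ hzr⟩

lemma dist_le_of_mem_segment {a b z z' : Pt} {r : ℝ} (h : dist a b ≤ r) (hz : z ∈ segment ℝ a b)
    (hz' : z' ∈ segment ℝ a b) : dist z' z ≤ r := by
  have h0 : 0 ≤ r := dist_nonneg.trans h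
  have h1 : dist z a ≤ r := Metric.mem_closedBall.1 ((convex_closedBall a r).segment_subset
    (Metric.mem_closedBall_self h0) (Metric.mem_closedBall.2 (by rwa [dist_comm])) hz)
  have h2 : dist z b ≤ r := Metric.mem_closedBall.1 ((convex_closedBall b r).segment_subset
    (Metric.mem_closedBall.2 h) (Metric.mem_closedBall_self h0) hz)
  exact Metric.mem_closedBall.1 ((convex_closedBall z r).segment_subset
    (Metric.mem_closedBall.2 (by rwa [dist_comm])) (Metric.mem_closedBall.2 (by rwa [dist_comm]))
    hz')

lemma exists_annulus_edges (hL : LocallyFinite L) (v : Pt) (r : ℝ) :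
    ∃ F : Finset E, ∀ e, e ∈ F ↔ MeetsAnnulus L v r e := by
  obtain ⟨M, hM⟩ := hL.2 (3 * r + 2)
  obtain ⟨F, -, hF⟩ := hM v
  refine ⟨F.filter (MeetsAnnulus L v r), fun e => ?_⟩
  rw [Finset.mem_filter, and_iff_right_iff_imp]
  rintro ⟨z, hz, -, hzr⟩
  refine hF e (Or.inl (Metric.mem_closedBall.2 ?_))
  have := dist_le_of_mem_segment (hL.1 e) hz (left_mem_segment ℝ _ _)
  have := dist_triangle (L.ends e).1 z v
  linarith

lemma Ex_prod_le {ι : Type*} {p : E → ℝ} (hp : ∀ e, p e ∈ Icc (0:ℝ) 1) (F : Finset E)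
    (s : Finset ι) {g : ι → Finset E → ℝ} (hg : ∀ i, Monotone (g i)) (h0 : ∀ i B, 0 ≤ g i B) :
    ∏ i ∈ s, Ex p F (g i) ≤ Ex p F fun B => ∏ i ∈ s, g i B := by
  induction s using Finset.induction_on with
  | empty => simp [Ex_const]
  | insert i s hi ih =>
    simp only [Finset.prod_insert hi]
    refine (mul_le_mul_of_nonneg_left ih (Ex_nonneg hp fun B _ => h0 i B)).trans
      (Ex_mul_le_of_monotone hp F (hg i) fun A B hAB => ?_)
    exact Finset.prod_le_prod (fun j _ => h0 j A) fun j _ => hg j hAB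

lemma Ex_sdiff (p : E → ℝ) (F : Finset E) (g : Finset E → ℝ) :
    Ex p F (fun B => g (F \ B)) = Ex (fun e => 1 - p e) F g := by
  induction F using Finset.induction_on generalizing g with
  | empty => simp [Ex_empty]
  | insert e F he ih =>
    rw [Ex_insert p he, Ex_insert _ he, ← ih g, ← ih fun B => g (insert e B)]
    have h1 : Ex p F (fun B => g (insert e F \ insert e B)) = Ex p F fun B => g (F \ B) := by
      refine Ex_congr fun B _ => ?_
      congr 1
      ext x
      simp only [Finset.mem_sdiff, Finset.mem_insert]
      by_cases hx : x = e
      · subst hx; simp [he]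
      · simp [hx]
    have h2 : Ex p F (fun B => g (insert e F \ B)) = Ex p F fun B => g (insert e (F \ B)) := by
      refine Ex_congr fun B hB => ?_
      rw [Finset.insert_sdiff_of_notMem _ fun h => he (hB h)]
    rw [h1, h2]
    ring

/-- Under the box-crossing property, circuits exist with probability bounded from below. -/
lemma exists_le_Ex_circuit {p : E → ℝ} (hp : ∀ e, p e ∈ Icc (0:ℝ) 1) {P : Measure (Config E)}
    (hP : IsBernoulliProduct p P) (hbox : BoxCrossingProperty L P) :
    ∃ η : ℝ, 0 < η ∧ η < 1 ∧ ∃ N₀ : ℕ, ∀ N : ℕ, N₀ ≤ N → ∀ v (F : Finset E),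
      (∀ e, e ∈ F ↔ MeetsAnnulus L v (N / 6) e) →
      η ≤ Ex p F fun B => if Circuit L v (N / 6) B then 1 else 0 := by
  obtain ⟨δ, hδ, N₀, hN₀⟩ := hbox (1 / 3) (by norm_num)
  set δ' := min δ (1 / 2) with hδ'
  have hδ0 : 0 < δ' := lt_min hδ (by norm_num)
  have hδ1 : δ' < 1 := (min_le_right _ _).trans_lt (by norm_num)
  have hcard : dirs.card ≠ 0 := by simp [dirs]
  refine ⟨δ' ^ dirs.card, by positivity, pow_lt_one₀ hδ0.le hδ1 hcard, N₀, fun N hN v F hF => ?_⟩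
  set r : ℝ := N / 6 with hr
  set g : ℝ → Finset E → ℝ := fun θ B =>
    if θ ∈ dirs ∧ Barrier L v r (cfg B) θ then 1 else 0 with hg
  have hnn : ∀ θ B, 0 ≤ g θ B := fun θ B => by simp only [hg]; split_ifs <;> norm_num
  have hmono : ∀ θ, Monotone (g θ) := by
    intro θ A B hAB
    simp only [hg]
    by_cases hA : θ ∈ dirs ∧ Barrier L v r (cfg A) θ
    · rw [if_pos hA, if_pos]
      refine ⟨hA.1, hA.2.mono hA.1 fun e _ he => ?_⟩
      simp only [cfg, decide_eq_true_eq] at he ⊢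
      exact hAB he
    · rw [if_neg hA]
      split_ifs <;> norm_num
  have hprob : ∀ θ ∈ dirs, δ' ≤ Ex p F (g θ) := by
    intro θ hθ
    have h1 := hN₀ N hN (fun z => rot θ z + (rot θ (r, -(3 * r)) + v)) ⟨θ, _, rfl⟩
    have hsub : {ω | HasBoxCrossings L ω (1 / 3 * N) N
        fun z => rot θ z + (rot θ (r, -(3 * r)) + v)} ⊆
        {ω | θ ∈ dirs ∧ Barrier L v r (cfg (opens F ω)) θ} := by
      intro ω hω
      have e1 : (1 / 3 * N : ℝ) = 2 * r := by rw [hr]; ring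
      have e2 : (N : ℝ) = 6 * r := by rw [hr]; ring
      have hω : HasBoxCrossings L ω (1 / 3 * N) N
        fun z => rot θ z + (rot θ (r, -(3 * r)) + v) := hω
      rw [e1, e2] at hω
      refine ⟨hθ, (barrier_of_hasBoxCrossings hω).mono hθ fun e he heω => ?_⟩
      simp [cfg, opens, heω, (hF e).2 he]
    have h2 := h1.trans (measure_mono hsub)
    rw [hP.measure_opens hp F fun B => θ ∈ dirs ∧ Barrier L v r (cfg B) θ] at h2
    exact (min_le_left _ _).trans ((ENNReal.ofReal_le_ofReal_iff (Ex_nonneg hp fun B _ =>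
      hnn θ B)).1 h2)
  calc δ' ^ dirs.card ≤ ∏ θ ∈ dirs, Ex p F (g θ) :=
by
        rw [← Finset.prod_const]
        exact Finset.prod_le_prod (fun _ _ => hδ0.le) hprob
    _ ≤ Ex p F fun B => ∏ θ ∈ dirs, g θ B := Ex_prod_le hp F dirs hmono hnn
    _ ≤ _ := by
        refine Ex_mono hp fun B _ => ?_
        rw [Finset.prod_ite_zero]
        simp only [Finset.prod_const_one]
        by_cases h : Circuit L v r B
        · rw [if_pos h]
          split_ifs <;> norm_num
        · rw [if_neg h, if_neg]
          exact fun h' => h fun θ hθ => (h' θ hθ).2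

/-- The probability that the primal cluster crosses `J` disjoint annuli decays exponentially. -/
lemma measure_radius_le_pow (hLd : LocallyFinite Ld)
    (hdual : ∀ e f, (segment ℝ (L.ends e).1 (L.ends e).2 ∩
      segment ℝ (Ld.ends f).1 (Ld.ends f).2).Nonempty → e = f)
    {p : E → ℝ} (hp : ∀ e, p e ∈ Icc (0:ℝ) 1) {Pd : Measure (Config E)}
    (hPd : IsBernoulliProduct (fun e => 1 - p e) Pd) (hbox : BoxCrossingProperty Ld Pd)
    {P : Measure (Config E)} (hP : IsBernoulliProduct p P) :
    ∃ η : ℝ, 0 < η ∧ η < 1 ∧ ∃ N : ℝ, 1 ≤ N ∧ ∀ v (J : ℕ) (R : ℝ), N * 4 ^ J ≤ R →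
      P {ω | ∃ u ∈ cluster L ω v, R ≤ dist u v} ≤ ENNReal.ofReal (η ^ J) := by
  have hp' : ∀ e, 1 - p e ∈ Icc (0:ℝ) 1 := fun e =>
    ⟨by linarith [(hp e).2], by linarith [(hp e).1]⟩
  obtain ⟨η, hη0, hη1, N₀, hN₀⟩ := exists_le_Ex_circuit hp' hPd hbox
  set N := max N₀ 25 with hN
  have hN25 : (25:ℝ) ≤ N := by exact_mod_cast le_max_right N₀ 25
  refine ⟨1 - η, by linarith, by linarith, N, by linarith, fun v J R hR => ?_⟩
  set r : ℕ → ℝ := fun j => ((N * 4 ^ j : ℕ) : ℝ) / 6 with hr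
  have hrv : ∀ j, r j = N * 4 ^ j / 6 := fun j => by simp [hr]
  have hpow : ∀ j, (1:ℝ) ≤ 4 ^ j := fun j => one_le_pow₀ (by norm_num)
  have hr4 : ∀ j, 4 < r j := fun j => by
    rw [hrv]
    nlinarith [hpow j]
  have hrmono : ∀ i j, i < j → 4 * r i ≤ r j := by
    intro i j hij
    have h1 : (4:ℝ) ^ (i + 1) ≤ 4 ^ j := pow_le_pow_right₀ (by norm_num) hij
    rw [hrv, hrv]
    rw [pow_succ] at h1
    nlinarith
  choose F hF using fun j => exists_annulus_edges hLd v (r j)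
  have hdisj : ∀ i j, i < j → Disjoint (F i) (F j) := by
    intro i j hij
    refine Finset.disjoint_left.2 fun e hi hj => ?_
    obtain ⟨z, hz, -, hz3⟩ := (hF i e).1 hi
    obtain ⟨z', hz', hz1, -⟩ := (hF j e).1 hj
    have h1 := dist_le_of_mem_segment (hLd.1 e) hz hz'
    have h2 := dist_triangle z' z v
    have := hrmono i j hij
    linarith [hr4 i]
  have hpd : ((Finset.range J : Finset ℕ) : Set ℕ).PairwiseDisjoint F := by
    intro i _ j _ hij
    rcases lt_or_gt_of_ne hij with h | h
    · exact hdisj i j h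
    · exact (hdisj j i h).symm
  set F' := (Finset.range J).biUnion F with hF'
  have hsub : {ω | ∃ u ∈ cluster L ω v, R ≤ dist u v} ⊆
      {ω | ∀ j ∈ Finset.range J, ¬ Circuit Ld v (r j) (F j \ opens F' ω)} := by
    rintro ω ⟨u, hu, hRu⟩ j hj hcirc
    have hj := Finset.mem_range.1 hj
    have h3 : 3 * r j ≤ R := by
      refine le_trans ?_ hR
      rw [hrv]
      have h1 : (4:ℝ) ^ j ≤ 4 ^ J := pow_le_pow_right₀ (by norm_num) hj.le
      nlinarith [hpow j]
    refine not_barrier_of_mem_cluster hdual (by linarith [hr4 j]) hu (h3.trans hRu)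
      fun θ hθ => (hcirc θ hθ).mono hθ fun e he hc => ?_
    have heF : e ∈ F' := Finset.mem_biUnion.2 ⟨j, Finset.mem_range.2 hj, (hF j e).2 he⟩
    simp only [cfg, decide_eq_true_eq, Finset.mem_sdiff, opens, Finset.mem_filter, heF,
      true_and] at hc
    simpa using hc.2
  refine (measure_mono hsub).trans ?_
  rw [hP.measure_opens hp F' fun B => ∀ j ∈ Finset.range J, ¬ Circuit Ld v (r j) (F j \ B)]
  refine ENNReal.ofReal_le_ofReal ?_
  calc Ex p F' (fun B => if ∀ j ∈ Finset.range J, ¬ Circuit Ld v (r j) (F j \ B) then 1 else 0)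
      = Ex p F' (fun B => ∏ j ∈ Finset.range J,
          if ¬ Circuit Ld v (r j) (F j \ B) then 1 else 0) := by
        refine Ex_congr fun B _ => ?_
        rw [Finset.prod_ite_zero]
        simp only [Finset.prod_const_one]
    _ = ∏ j ∈ Finset.range J, Ex p (F j) fun B =>
          if ¬ Circuit Ld v (r j) (F j \ B) then 1 else 0 := by
        refine Ex_prod_biUnion p _ F hpd _ fun j _ B => ?_
        have : F j \ (B ∩ F j) = F j \ B := by
          ext x
          simp only [Finset.mem_sdiff, Finset.mem_inter]
          tauto
        rw [this]
    _ ≤ ∏ j ∈ Finset.range J, (1 - η) := by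
        refine Finset.prod_le_prod (fun j _ => Ex_nonneg hp fun B _ => by
          split_ifs <;> norm_num) fun j _ => ?_
        rw [Ex_sdiff p (F j) fun B => if ¬ Circuit Ld v (r j) B then 1 else 0]
        have h1 : Ex (fun e => 1 - p e) (F j)
            (fun B => if ¬ Circuit Ld v (r j) B then (1:ℝ) else 0) =
            Ex (fun e => 1 - p e) (F j) fun B => 1 - if Circuit Ld v (r j) B then (1:ℝ) else 0 := by
          refine Ex_congr fun B _ => ?_
          split_ifs <;> norm_num
        rw [h1, Ex_sub, Ex_const]
        have h2 : N₀ ≤ N * 4 ^ j := (le_max_left _ _).trans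
          (Nat.le_mul_of_pos_right _ (by positivity))
        have := hN₀ _ h2 v (F j) (hF j)
        linarith
    _ = (1 - η) ^ J := by simp

/-- Power-law decay of the radius. -/
lemma exists_radius_decay (hLd : LocallyFinite Ld)
    (hdual : ∀ e f, (segment ℝ (L.ends e).1 (L.ends e).2 ∩
      segment ℝ (Ld.ends f).1 (Ld.ends f).2).Nonempty → e = f)
    {p : E → ℝ} (hp : ∀ e, p e ∈ Icc (0:ℝ) 1) {Pd : Measure (Config E)}
    (hPd : IsBernoulliProduct (fun e => 1 - p e) Pd) (hbox : BoxCrossingProperty Ld Pd)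
    {P : Measure (Config E)} (hP : IsBernoulliProduct p P) :
    ∃ a : ℝ, 0 < a ∧ ∃ b : ℝ, 0 < b ∧ ∀ v (R : ℝ), 0 < R →
      P {ω | ∃ u ∈ cluster L ω v, R ≤ dist u v} ≤ ENNReal.ofReal (a * R ^ (-b)) := by
  obtain ⟨η, hη0, hη1, N, hN, h⟩ := measure_radius_le_pow hLd hdual hp hPd hbox hP
  have := hP.1
  have hN0 : 0 < N := by linarith
  set b : ℝ := -Real.log η / Real.log 4 with hb
  have hl4 : 0 < Real.log 4 := Real.log_pos (by norm_num)
  have hb0 : 0 < b := div_pos (neg_pos.2 (Real.log_neg hη0 hη1)) hl4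
  have hη4 : (4:ℝ) ^ (-b) = η := by
    rw [Real.rpow_def_of_pos (by norm_num), hb, neg_div, neg_neg, mul_div_cancel₀ _ hl4.ne',
      Real.exp_log hη0]
  have key : ∀ R : ℝ, 0 < R → ∀ J : ℕ, R ≤ N * 4 ^ (J + 1) →
      η ^ J ≤ η⁻¹ * N ^ b * R ^ (-b) := by
    intro R hR J hRJ
    have h1 : (N * 4 ^ (J + 1)) ^ (-b) ≤ R ^ (-b) :=
      Real.rpow_le_rpow_of_nonpos hR hRJ (by linarith)
    rw [Real.mul_rpow hN0.le (by positivity), ← Real.rpow_natCast, ← Real.rpow_mul (by norm_num),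
      mul_comm _ (-b), Real.rpow_mul (by norm_num), hη4, Real.rpow_natCast] at h1
    calc η ^ J = η⁻¹ * N ^ b * (N ^ (-b) * η ^ (J + 1)) := by
          have h2 : N ^ b * N ^ (-b) = 1 := by rw [← Real.rpow_add hN0]; simp
          calc η ^ J = η⁻¹ * η ^ (J + 1) * 1 := by
                rw [pow_succ]
                field_simp
            _ = _ := by rw [← h2]; ring
      _ ≤ _ := mul_le_mul_of_nonneg_left h1 (by positivity)
  refine ⟨η⁻¹ * N ^ b, by positivity, b, hb0, fun v R hR => ?_⟩
  rcases le_or_gt N R with hRN | hRN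
  · obtain ⟨J, hJ1, hJ2⟩ := exists_nat_pow_near ((one_le_div hN0).2 hRN)
      (show (1:ℝ) < 4 by norm_num)
    rw [le_div_iff₀' hN0] at hJ1
    rw [div_lt_iff₀' hN0] at hJ2
    exact (h v J R hJ1).trans (ENNReal.ofReal_le_ofReal (key R hR J hJ2.le))
  · refine prob_le_one.trans ?_
    rw [← ENNReal.ofReal_one]
    refine ENNReal.ofReal_le_ofReal ?_
    have := key R hR 0 (by norm_num; linarith)
    simpa using this

end Annuli

section Assembly

variable {E : Type} {L Ld : LatticeOn E}

lemma edist2_le_two_mul_dist (v u : Pt) : edist2 v u ≤ 2 * dist u v := by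
  have h1 : |v.1 - u.1| ≤ dist u v := by
    rw [dist_comm, ← Real.dist_eq]
    exact le_max_left _ _
  have h2 : |v.2 - u.2| ≤ dist u v := by
    rw [dist_comm, ← Real.dist_eq]
    exact le_max_right _ _
  have h0 : 0 ≤ dist u v := dist_nonneg
  refine Real.sqrt_le_iff.2 ⟨by positivity, ?_⟩
  have := sq_le_sq' (by linarith [neg_abs_le (v.1 - u.1)]) ((le_abs_self _).trans h1)
  have := sq_le_sq' (by linarith [neg_abs_le (v.2 - u.2)]) ((le_abs_self _).trans h2)
  nlinarith

lemma exists_le_dist_of_radiusGE {ω : Config E} {v : Pt} {k : ℝ} (hk : 0 < k)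
    (h : RadiusGE L ω v k) : ∃ u ∈ cluster L ω v, k / 4 ≤ dist u v := by
  obtain ⟨u, hu, hku⟩ := h (k / 2) (by linarith)
  exact ⟨u, hu, by linarith [edist2_le_two_mul_dist v u]⟩

lemma eq_or_exists_touches {ω : Config E} {u v : Pt} (h : u ∈ cluster L ω v) :
    u = v ∨ ∃ e, u = (L.ends e).1 ∨ u = (L.ends e).2 := by
  rcases Relation.ReflTransGen.cases_tail h with h | ⟨w, -, e, -, h | h⟩
  · exact Or.inl h
  · exact Or.inr ⟨e, Or.inr (by rw [h])⟩
  · exact Or.inr ⟨e, Or.inl (by rw [h])⟩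

lemma exists_le_dist_of_infinite (hL : LocallyFinite L) {ω : Config E} {v : Pt}
    (h : (cluster L ω v).Infinite) (R : ℝ) : ∃ u ∈ cluster L ω v, R ≤ dist u v := by
  by_contra! hR
  obtain ⟨M, hM⟩ := hL.2 R
  obtain ⟨F, -, hF⟩ := hM v
  classical
  refine h (Set.Finite.subset (Finset.finite_toSet
    (insert v (F.image (fun e => (L.ends e).1) ∪ F.image fun e => (L.ends e).2))) fun u hu => ?_)
  have hb : u ∈ Metric.closedBall v R := Metric.mem_closedBall.2 (hR u hu).le
  simp only [Finset.coe_insert, Finset.coe_union, Finset.coe_image, mem_insert_iff, mem_union,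
    mem_image]
  rcases eq_or_exists_touches hu with h | ⟨e, rfl | rfl⟩
  · exact Or.inl h
  · exact Or.inr (Or.inl ⟨e, hF e (Or.inl hb), rfl⟩)
  · exact Or.inr (Or.inr ⟨e, hF e (Or.inr hb), rfl⟩)

lemma exists_mul_rpow_neg_le (a : ℝ) {b ε : ℝ} (hb : 0 < b) (hε : 0 < ε) :
    ∃ R : ℝ, 0 < R ∧ a * R ^ (-b) ≤ ε := by
  have h := (tendsto_rpow_neg_atTop hb).const_mul a
  rw [mul_zero] at h
  obtain ⟨R, hR0, hR⟩ := ((Filter.eventually_gt_atTop (0:ℝ)).and (h.eventually_le_const hε)).exists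
  exact ⟨R, hR0, hR⟩

/-- The box-crossing property of the dual measure implies subcriticality, for any locally finite
pair of lattices in which an edge meets a dual edge only if they are indexed alike. -/
lemma subcriticalityViaBXP_of_locallyFinite [Countable E] (hL : LocallyFinite L)
    (hLd : LocallyFinite Ld)
    (hdual : ∀ e f, (segment ℝ (L.ends e).1 (L.ends e).2 ∩
      segment ℝ (Ld.ends f).1 (Ld.ends f).2).Nonempty → e = f) :
    SubcriticalityViaBXP L Ld := by
  intro p hp Pd hPd hbox P hP
  obtain ⟨a, ha, b, hb, hab⟩ := exists_radius_decay hLd hdual hp hPd hbox hP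
  refine ⟨⟨a * 4 ^ b, by positivity, b, hb, fun v _ k hk => ?_⟩, ?_, fun ν hν => ?_⟩
  · have hk0 : (0:ℝ) < k := by exact_mod_cast hk
    refine (measure_mono fun ω hω => exists_le_dist_of_radiusGE hk0 hω).trans
      ((hab v (k / 4) (by positivity)).trans (ENNReal.ofReal_le_ofReal (le_of_eq ?_)))
    rw [Real.div_rpow hk0.le (by norm_num), Real.rpow_neg (by norm_num : (0:ℝ) ≤ 4), div_inv_eq_mul]
    ring
  · have hcount : (vertexSet L).Countable :=
      countable_iUnion fun e => (Set.toFinite _).countable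
    have hset : {ω | ∃ v ∈ vertexSet L, (cluster L ω v).Infinite} =
        ⋃ v ∈ vertexSet L, {ω | (cluster L ω v).Infinite} := by
      ext ω
      simp
    rw [hset, measure_biUnion_null_iff hcount]
    refine fun v _ => nonpos_iff_eq_zero.1 (ENNReal.le_of_forall_pos_le_add fun ε hε _ => ?_)
    obtain ⟨R, hR0, hR⟩ := exists_mul_rpow_neg_le a hb (NNReal.coe_pos.2 hε)
    rw [zero_add, ← ENNReal.ofReal_coe_nnreal]
    exact (measure_mono fun ω hω => exists_le_dist_of_infinite hL hω R).trans
      ((hab v R hR0).trans (ENNReal.ofReal_le_ofReal hR))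
  · obtain ⟨c, hc, d, hd, h⟩ := exists_exp_decay hL hν hp hP fun ε hε => by
      obtain ⟨R, hR0, hR⟩ := exists_mul_rpow_neg_le a hb hε
      exact ⟨R, fun v => (hab v R hR0).trans (ENNReal.ofReal_le_ofReal hR)⟩
    exact ⟨c, hc, d, hd, fun Pu hPu v _ k => h Pu hPu v k⟩

end Assembly

section Lattices

lemma locallyFinite_of_coords {ι : Type} [Fintype ι] {L : LatticeOn (ℤ × ℤ × ι)}
    (hdist : ∀ e, dist (L.ends e).1 (L.ends e).2 ≤ 2) (f g : Pt → ℝ)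
    (hf : ∀ z v, |f z - f v| ≤ dist z v) (hg : ∀ z v, |g z - g v| ≤ dist z v)
    (h : ∀ e z, z = (L.ends e).1 ∨ z = (L.ends e).2 → |f z - e.1| ≤ 2 ∧ |g z - e.2.1| ≤ 2) :
    LocallyFinite L := by
  refine ⟨hdist, fun R => ?_⟩
  set m : ℤ := ⌈R⌉ + 3 with hm
  refine ⟨(2 * m + 1).toNat * ((2 * m + 1).toNat * Fintype.card ι), fun v =>
    ⟨Finset.Icc (⌊f v⌋ - m) (⌊f v⌋ + m) ×ˢ Finset.Icc (⌊g v⌋ - m) (⌊g v⌋ + m) ×ˢ Finset.univ,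
      le_of_eq ?_, fun e he => ?_⟩⟩
  · have h1 : ∀ x : ℤ, x + m + 1 - (x - m) = 2 * m + 1 := fun x => by ring
    simp [h1]
  · have key : ∀ (n : ℤ) (x y : ℝ), |y - n| ≤ 2 → |y - x| ≤ R →
        n ∈ Finset.Icc (⌊x⌋ - m) (⌊x⌋ + m) := by
      intro n x y h1 h2
      rw [abs_le] at h1 h2
      have h3 := Int.le_ceil R
      have h4 := Int.floor_le x
      have h5 := Int.lt_floor_add_one x
      rw [Finset.mem_Icc, hm]
      constructor
      · have : ((⌊x⌋ - (⌈R⌉ + 3) : ℤ) : ℝ) ≤ n := by push_cast; linarith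
        exact_mod_cast this
      · have : (n : ℝ) ≤ (⌊x⌋ + (⌈R⌉ + 3) : ℤ) := by push_cast; linarith
        exact_mod_cast this
    obtain ⟨z, hz, hzv⟩ : ∃ z, (z = (L.ends e).1 ∨ z = (L.ends e).2) ∧ dist z v ≤ R :=
      he.elim (fun h => ⟨_, Or.inl rfl, Metric.mem_closedBall.1 h⟩)
        fun h => ⟨_, Or.inr rfl, Metric.mem_closedBall.1 h⟩
    simp only [Finset.mem_product, Finset.mem_univ, and_true]
    exact ⟨key _ _ _ (h e z hz).1 ((hf z v).trans hzv), key _ _ _ (h e z hz).2 ((hg z v).trans hzv)⟩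

lemma abs_fst_sub_le_dist (z v : Pt) : |z.1 - v.1| ≤ dist z v := by
  rw [← Real.dist_eq]
  exact le_max_left _ _

lemma abs_snd_sub_le_dist (z v : Pt) : |z.2 - v.2| ≤ dist z v := by
  rw [← Real.dist_eq]
  exact le_max_right _ _

lemma dist_le_of_abs {z v : Pt} {r : ℝ} (h1 : |z.1 - v.1| ≤ r) (h2 : |z.2 - v.2| ≤ r) :
    dist z v ≤ r := by
  rw [Prod.dist_eq, Real.dist_eq, Real.dist_eq]
  exact max_le h1 h2

lemma mem_Icc_of_mem_segment (φ : Pt →ₗ[ℝ] ℝ) {a b z : Pt} {l u : ℝ} (ha : φ a ∈ Icc l u)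
    (hb : φ b ∈ Icc l u) (hz : z ∈ segment ℝ a b) : φ z ∈ Icc l u :=
  ((convex_Icc l u).linear_preimage φ).segment_subset ha hb hz

lemma int_eq_of_lt {m n : ℤ} (h1 : (m : ℝ) < n + 1) (h2 : (n : ℝ) < m + 1) : m = n := by
  have h1 : m < n + 1 := by exact_mod_cast h1
  have h2 : n < m + 1 := by exact_mod_cast h2
  omega

lemma false_of_int_lt {m n : ℤ} (h1 : (m : ℝ) < n) (h2 : (n : ℝ) < m + 1) : False := by
  have h1 : m < n := by exact_mod_cast h1
  have h2 : n < m + 1 := by exact_mod_cast h2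
  omega

lemma locallyFinite_sqLattice : LocallyFinite sqLattice := by
  refine locallyFinite_of_coords (fun e => ?_) Prod.fst Prod.snd abs_fst_sub_le_dist
    abs_snd_sub_le_dist fun e z hz => ?_
  · obtain ⟨a, b, _ | _⟩ := e <;>
      refine dist_le_of_abs (abs_le.2 ⟨?_, ?_⟩) (abs_le.2 ⟨?_, ?_⟩) <;>
      simp [sqLattice] <;> linarith
  · obtain ⟨a, b, _ | _⟩ := e <;> obtain rfl | rfl := hz <;> simp [sqLattice]

lemma locallyFinite_sqDualLattice : LocallyFinite sqDualLattice := by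
  refine locallyFinite_of_coords (fun e => ?_) Prod.fst Prod.snd abs_fst_sub_le_dist
    abs_snd_sub_le_dist fun e z hz => ?_
  · obtain ⟨a, b, _ | _⟩ := e <;>
      refine dist_le_of_abs (abs_le.2 ⟨?_, ?_⟩) (abs_le.2 ⟨?_, ?_⟩) <;>
      simp [sqDualLattice] <;> linarith
  · obtain ⟨a, b, _ | _⟩ := e <;> obtain rfl | rfl := hz <;>
      refine ⟨abs_le.2 ⟨?_, ?_⟩, abs_le.2 ⟨?_, ?_⟩⟩ <;> simp [sqDualLattice] <;> linarith

lemma mem_Icc_of_mem_sqLattice {a b : ℤ} {c : Bool} {z : Pt}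
    (hz : z ∈ segment ℝ (sqLattice.ends (a, b, c)).1 (sqLattice.ends (a, b, c)).2) :
    (z.1 ∈ Icc (a : ℝ) (a + if c then 1 else 0)) ∧ z.2 ∈ Icc (b : ℝ) (b + if c then 0 else 1) := by
  refine ⟨mem_Icc_of_mem_segment (LinearMap.fst ℝ ℝ ℝ) ?_ ?_ hz,
    mem_Icc_of_mem_segment (LinearMap.snd ℝ ℝ ℝ) ?_ ?_ hz⟩ <;>
  cases c <;> simp [sqLattice]

lemma mem_Icc_of_mem_sqDualLattice {a b : ℤ} {c : Bool} {z : Pt}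
    (hz : z ∈ segment ℝ (sqDualLattice.ends (a, b, c)).1 (sqDualLattice.ends (a, b, c)).2) :
    (z.1 ∈ Icc ((a : ℝ) + if c then 1 / 2 else - 1 / 2) (a + 1 / 2)) ∧
      z.2 ∈ Icc ((b : ℝ) + if c then - 1 / 2 else 1 / 2) (b + 1 / 2) := by
  refine ⟨mem_Icc_of_mem_segment (LinearMap.fst ℝ ℝ ℝ) ?_ ?_ hz,
    mem_Icc_of_mem_segment (LinearMap.snd ℝ ℝ ℝ) ?_ ?_ hz⟩ <;>
  cases c <;> refine ⟨?_, ?_⟩ <;> simp [sqDualLattice] <;> linarith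

lemma eq_of_sqLattice_inter (e f : SqE)
    (h : (segment ℝ (sqLattice.ends e).1 (sqLattice.ends e).2 ∩
      segment ℝ (sqDualLattice.ends f).1 (sqDualLattice.ends f).2).Nonempty) : e = f := by
  obtain ⟨z, hz, hz'⟩ := h
  obtain ⟨a, b, c⟩ := e
  obtain ⟨a', b', c'⟩ := f
  obtain ⟨⟨h1, h2⟩, h3, h4⟩ := mem_Icc_of_mem_sqLattice hz
  obtain ⟨⟨h5, h6⟩, h7, h8⟩ := mem_Icc_of_mem_sqDualLattice hz'
  cases c <;> cases c' <;> simp only [if_true, Bool.false_eq_true, if_false] at *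
  · rw [int_eq_of_lt (m := a) (n := a') (by linarith) (by linarith),
      int_eq_of_lt (m := b) (n := b') (by linarith) (by linarith)]
  · exact (false_of_int_lt (m := a') (n := a) (by linarith) (by linarith)).elim
  · exact (false_of_int_lt (m := b') (n := b) (by linarith) (by linarith)).elim
  · rw [int_eq_of_lt (m := a) (n := a') (by linarith) (by linarith),
      int_eq_of_lt (m := b) (n := b') (by linarith) (by linarith)]

/-- The first affine coordinate with respect to the triangular lattice. -/
noncomputable def triX : Pt →ₗ[ℝ] ℝ :=
  (√3)⁻¹ • LinearMap.fst ℝ ℝ ℝ - (1 / 3 : ℝ) • LinearMap.snd ℝ ℝ ℝ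

/-- The second affine coordinate with respect to the triangular lattice. -/
noncomputable def triY : Pt →ₗ[ℝ] ℝ := (2 / 3 : ℝ) • LinearMap.snd ℝ ℝ ℝ

lemma triX_apply (z : Pt) : triX z = (√3)⁻¹ * z.1 - 1 / 3 * z.2 := rfl

lemma triY_apply (z : Pt) : triY z = 2 / 3 * z.2 := rfl

lemma inv_sqrt_three_mul (x : ℝ) : (√3)⁻¹ * (√3 * x) = x :=
  inv_mul_cancel_left₀ (by positivity) x

lemma triX_tv (a b : ℤ) : triX (tv a b) = a := by
  rw [triX_apply, tv, inv_sqrt_three_mul]; ring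

lemma triY_tv (a b : ℤ) : triY (tv a b) = b := by
  rw [triY_apply, tv]; ring

lemma triX_hup (a b : ℤ) : triX (hup a b) = a + 1 / 3 := by
  rw [triX_apply, hup, inv_sqrt_three_mul]; ring

lemma triY_hup (a b : ℤ) : triY (hup a b) = b + 1 / 3 := by
  rw [triY_apply, hup]; ring

lemma triX_hdown (a b : ℤ) : triX (hdown a b) = a + 2 / 3 := by
  rw [triX_apply, hdown, inv_sqrt_three_mul]; ring

lemma triY_hdown (a b : ℤ) : triY (hdown a b) = b - 1 / 3 := by
  rw [triY_apply, hdown]; ring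

lemma abs_triY_sub_le (z v : Pt) : |triY z - triY v| ≤ dist z v := by
  have := abs_le.1 (abs_snd_sub_le_dist z v)
  have := dist_nonneg (x := z) (y := v)
  rw [triY_apply, triY_apply, abs_le]
  constructor <;> linarith

lemma abs_triX_sub_le (z v : Pt) : |triX z - triX v| ≤ dist z v := by
  have h1 := abs_le.1 (abs_fst_sub_le_dist z v)
  have h2 := abs_le.1 (abs_snd_sub_le_dist z v)
  have h3 : (√3)⁻¹ ≤ 2 / 3 := by
    rw [inv_le_comm₀ (by positivity) (by norm_num)]
    exact Real.le_sqrt_of_sq_le (by norm_num)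
  have h4 : 0 < (√3)⁻¹ := by positivity
  have h0 := dist_nonneg (x := z) (y := v)
  rw [triX_apply, triX_apply, abs_le]
  constructor <;> nlinarith

lemma dist_le_two_of_tri {z v : Pt} (h1 : |triX z - triX v| ≤ 1) (h2 : |triY z - triY v| ≤ 1)
    (h3 : |triX z + triY z - (triX v + triY v)| ≤ 1) : dist z v ≤ 2 := by
  have hs : √3 ≤ 2 := by rw [Real.sqrt_le_iff]; norm_num
  have h0 : 0 < √3 := by positivity
  have e1 : z.1 - v.1 =
      √3 * ((triX z - triX v) / 2 + (triX z + triY z - (triX v + triY v)) / 2) := by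
    simp only [triX_apply, triY_apply]
    field_simp
    ring
  have e2 : z.2 - v.2 = 3 / 2 * (triY z - triY v) := by
    simp only [triY_apply]
    ring
  rw [abs_le] at h1 h2 h3
  refine dist_le_of_abs (abs_le.2 ?_) (abs_le.2 ?_)
  · rw [e1]
    constructor <;> nlinarith
  · rw [e2]
    constructor <;> linarith

lemma locallyFinite_triLattice : LocallyFinite triLattice := by
  refine locallyFinite_of_coords (fun e => ?_) triX triY abs_triX_sub_le
    abs_triY_sub_le fun e z hz => ?_
  · obtain ⟨a, b, c⟩ := e
    fin_cases c <;> refine dist_le_two_of_tri (abs_le.2 ⟨?_, ?_⟩) (abs_le.2 ⟨?_, ?_⟩)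
      (abs_le.2 ⟨?_, ?_⟩) <;> simp [triLattice, triX_tv, triY_tv] <;> linarith
  · obtain ⟨a, b, c⟩ := e
    fin_cases c <;> obtain rfl | rfl := hz <;> refine ⟨abs_le.2 ⟨?_, ?_⟩, abs_le.2 ⟨?_, ?_⟩⟩ <;>
      simp [triLattice, triX_tv, triY_tv] <;> linarith

lemma locallyFinite_hexLattice : LocallyFinite hexLattice := by
  refine locallyFinite_of_coords (fun e => ?_) triX triY abs_triX_sub_le
    abs_triY_sub_le fun e z hz => ?_
  · obtain ⟨a, b, c⟩ := e
    fin_cases c <;> refine dist_le_two_of_tri (abs_le.2 ⟨?_, ?_⟩) (abs_le.2 ⟨?_, ?_⟩)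
      (abs_le.2 ⟨?_, ?_⟩) <;>
      simp [hexLattice, triX_hup, triY_hup, triX_hdown, triY_hdown] <;> linarith
  · obtain ⟨a, b, c⟩ := e
    fin_cases c <;> obtain rfl | rfl := hz <;> refine ⟨abs_le.2 ⟨?_, ?_⟩, abs_le.2 ⟨?_, ?_⟩⟩ <;>
      simp [hexLattice, triX_hup, triY_hup, triX_hdown, triY_hdown] <;> linarith

lemma mem_Icc_of_mem_triLattice {a b : ℤ} {c : Fin 3} {z : Pt}
    (hz : z ∈ segment ℝ (triLattice.ends (a, b, c)).1 (triLattice.ends (a, b, c)).2) :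
    triX z ∈ Icc (a : ℝ) (a + ![1, 1, 0] c) ∧ triY z ∈ Icc (b : ℝ) (b + ![0, 1, 1] c) ∧
      (triX + triY) z ∈ Icc ((a : ℝ) + b + ![0, 1, 0] c) (a + b + 1) := by
  refine ⟨mem_Icc_of_mem_segment triX ?_ ?_ hz, mem_Icc_of_mem_segment triY ?_ ?_ hz,
    mem_Icc_of_mem_segment (triX + triY) ?_ ?_ hz⟩ <;>
  fin_cases c <;> refine ⟨?_, ?_⟩ <;> simp [triLattice, triX_tv, triY_tv] <;> linarith

lemma mem_Icc_of_mem_hexLattice {a b : ℤ} {c : Fin 3} {z : Pt}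
    (hz : z ∈ segment ℝ (hexLattice.ends (a, b, c)).1 (hexLattice.ends (a, b, c)).2) :
    triX z ∈ Icc ((a : ℝ) + ![1 / 3, 1 / 3, -1 / 3] c) (a + ![2 / 3, 2 / 3, 1 / 3] c) ∧
      triY z ∈ Icc ((b : ℝ) + ![-1 / 3, 1 / 3, 1 / 3] c) (b + ![1 / 3, 2 / 3, 2 / 3] c) ∧
      (triX + triY) z ∈ Icc ((a : ℝ) + b + ![1 / 3, 2 / 3, 1 / 3] c)
        (a + b + ![2 / 3, 4 / 3, 2 / 3] c) := by
  refine ⟨mem_Icc_of_mem_segment triX ?_ ?_ hz, mem_Icc_of_mem_segment triY ?_ ?_ hz,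
    mem_Icc_of_mem_segment (triX + triY) ?_ ?_ hz⟩ <;>
  fin_cases c <;> refine ⟨?_, ?_⟩ <;>
    simp [hexLattice, triX_hup, triY_hup, triX_hdown, triY_hdown] <;> linarith

lemma eq_of_triLattice_inter (e f : TriE)
    (h : (segment ℝ (triLattice.ends e).1 (triLattice.ends e).2 ∩
      segment ℝ (hexLattice.ends f).1 (hexLattice.ends f).2).Nonempty) : e = f := by
  obtain ⟨z, hz, hz'⟩ := h
  obtain ⟨a, b, c⟩ := e
  obtain ⟨a', b', c'⟩ := f
  obtain ⟨⟨h1, h2⟩, ⟨h3, h4⟩, h5, h6⟩ := mem_Icc_of_mem_triLattice hz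
  obtain ⟨⟨k1, k2⟩, ⟨k3, k4⟩, k5, k6⟩ := mem_Icc_of_mem_hexLattice hz'
  have hsum : ((a + b : ℤ) : ℝ) = a + b := by push_cast; ring
  have hsum' : ((a' + b' : ℤ) : ℝ) = a' + b' := by push_cast; ring
  fin_cases c <;> fin_cases c' <;> simp at h1 h2 h3 h4 h5 h6 k1 k2 k3 k4 k5 k6
  · rw [int_eq_of_lt (m := a) (n := a') (by linarith) (by linarith),
      int_eq_of_lt (m := b) (n := b') (by linarith) (by linarith)]
  · exact (false_of_int_lt (m := b') (n := b) (by linarith) (by linarith)).elim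
  · exact (false_of_int_lt (m := b') (n := b) (by linarith) (by linarith)).elim
  · exact (false_of_int_lt (m := a' + b') (n := a + b + 1) (by push_cast; linarith)
      (by push_cast; linarith)).elim
  · have ha := int_eq_of_lt (m := a) (n := a') (by linarith) (by linarith)
    have hab := int_eq_of_lt (m := a + b) (n := a' + b') (by linarith) (by linarith)
    rw [ha, show b = b' by omega]
  · exact (false_of_int_lt (m := a' + b') (n := a + b + 1) (by push_cast; linarith)
      (by push_cast; linarith)).elim
  · exact (false_of_int_lt (m := a') (n := a) (by linarith) (by linarith)).elim
  · exact (false_of_int_lt (m := a') (n := a) (by linarith) (by linarith)).elim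
  · rw [int_eq_of_lt (m := a) (n := a') (by linarith) (by linarith),
      int_eq_of_lt (m := b) (n := b') (by linarith) (by linarith)]

end Lattices

/-- For each of the square, triangular and hexagonal lattices
(with respective duals the shifted square, hexagonal and triangular lattices):
if the dual measure `P*_{1-p}` has the box-crossing property then (a) the radius of an
open cluster has uniform polynomial decay, (b) a.s. there is no infinite open cluster,
and (c) for every `ν > 0`, cluster volumes under `\underline{P}_{p-ν}` have uniform
exponential tails. -/
theorem subcriticality_via_box_crossing :
    SubcriticalityViaBXP sqLattice sqDualLattice ∧
    SubcriticalityViaBXP triLattice hexLattice ∧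
    SubcriticalityViaBXP hexLattice triLattice := by
  refine ⟨subcriticalityViaBXP_of_locallyFinite locallyFinite_sqLattice locallyFinite_sqDualLattice
      eq_of_sqLattice_inter,
    subcriticalityViaBXP_of_locallyFinite locallyFinite_triLattice locallyFinite_hexLattice
      eq_of_triLattice_inter,
    subcriticalityViaBXP_of_locallyFinite locallyFinite_hexLattice locallyFinite_triLattice
      fun e f h => ?_⟩
  rw [inter_comm] at h
  exact (eq_of_triLattice_inter f e h).symm

end Perc
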